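/- Let n ≥ 1 and k ≥ 1 be integers. Suppose there exists a homogeneous polynomial of degree k in ℂ[z_0, …, z_n] whose zero locus in ℙⁿ(ℂ) is a smooth Brody hyperbolic hypersurface. Let δ be a multiple of k with δ ≥ (n + 3)k. Then there exists a homogeneous polynomial G ∈ ℂ[z_0, …, z_n] of degree δ such that the hypersurface W = {z_{n+1}^{δ} = G(z_0, …, z_n)} ⊆ ℙ^{n+1}(ℂ) is smooth and Brody hyperbolic. -/

import Mathlib

open MvPolynomial

/-- The hypersurface `{F = 0} ⊆ ℙ^{q-1}(ℂ)` is Brody hyperbolic. -/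
def IsBrodyHyperbolicHypersurface {q : ℕ} (F : MvPolynomial (Fin q) ℂ) : Prop :=
  ∀ f : Fin q → ℂ → ℂ,
    (∀ i, Differentiable ℂ (f i)) →
    (∀ z : ℂ, ∃ i, f i z ≠ 0) →
    (∀ z : ℂ, MvPolynomial.eval (fun i => f i z) F = 0) →
    ∃ (c : Fin q → ℂ) (u : ℂ → ℂ), Differentiable ℂ u ∧ ∀ i z, f i z = c i * u z

/-- The hypersurface `{F = 0} ⊆ ℙ^{q-1}(ℂ)` is smooth. -/
def IsSmoothHypersurface {q : ℕ} (F : MvPolynomial (Fin q) ℂ) : Prop :=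
  ∀ x : Fin q → ℂ, x ≠ 0 → MvPolynomial.eval x F = 0 →
    ∃ i, MvPolynomial.eval x (MvPolynomial.pderiv i F) ≠ 0

section

open Metric Filter Topology Set

/-- Montel's theorem along an ultrafilter: uniformly bounded holomorphic functions on a disc
converge, together with their derivatives. -/
lemma exists_differentiableOn_tendsto_of_bounded {𝒰 : Ultrafilter ℕ} {h : ℕ → ℂ → ℂ} {p : ℂ}
    {ρ C : ℝ} (hh : ∀ᶠ j in (𝒰 : Filter ℕ), DifferentiableOn ℂ (h j) (ball p ρ) ∧
      ∀ y ∈ ball p ρ, ‖h j y‖ ≤ C) :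
    ∃ H : ℂ → ℂ, DifferentiableOn ℂ H (ball p ρ) ∧
      (∀ y ∈ ball p ρ, Tendsto (fun j => h j y) 𝒰 (𝓝 (H y))) ∧
      ∀ y ∈ ball p ρ, Tendsto (fun j => deriv (h j) y) 𝒰 (𝓝 (deriv H y)) := by
  have hpt : ∀ y, ∃ a, y ∈ ball p ρ → Tendsto (fun j => h j y) 𝒰 (𝓝 a) := by
    intro y
    by_cases hy : y ∈ ball p ρ
    · obtain ⟨a, -, ha⟩ := (isCompact_closedBall (0 : ℂ) C).ultrafilter_le_nhds
        (𝒰.map fun j => h j y) (by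
          rw [le_principal_iff]
          change ∀ᶠ j in (𝒰 : Filter ℕ), h j y ∈ closedBall (0 : ℂ) C
          filter_upwards [hh] with j hj
          simpa using hj.2 y hy)
      exact ⟨a, fun _ => ha⟩
    · exact ⟨0, fun h => absurd h hy⟩
  choose H hH using hpt
  have hloc : TendstoLocallyUniformlyOn h H 𝒰 (ball p ρ) := by
    rw [Metric.tendstoLocallyUniformlyOn_iff]
    intro ε hε x hx
    obtain ⟨r, hr, hrb⟩ := Metric.isOpen_iff.1 isOpen_ball x hx
    set L : ℝ := C / (r / 3) with hL
    have hlip : ∀ᶠ j in (𝒰 : Filter ℕ), ∀ y ∈ ball x (r / 3), ‖h j y - h j x‖ ≤ L * ‖y - x‖ := by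
      filter_upwards [hh] with j hj y hy
      refine (convex_ball x (r / 3)).norm_image_sub_le_of_norm_deriv_le (𝕜 := ℂ) ?_ ?_
        (mem_ball_self (by positivity)) hy
      · intro z hz
        refine hj.1.differentiableAt (isOpen_ball.mem_nhds (hrb ?_))
        exact ball_subset_ball (by linarith) hz
      · intro z hz
        have hsub : closedBall z (r / 3) ⊆ ball p ρ := fun w hw => hrb (by
          rw [mem_ball] at hz ⊢; rw [mem_closedBall] at hw
          linarith [dist_triangle w z x])
        refine Complex.norm_deriv_le_of_forall_mem_sphere_norm_le (by positivity) ?_ ?_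
        · exact DifferentiableOn.diffContOnCl_ball (U := ball p ρ) hj.1 hsub
        · exact fun w hw => hj.2 w (hsub (sphere_subset_closedBall hw))
    have hL0 : 0 ≤ L := by
      obtain ⟨j, hj⟩ := hh.exists
      have : 0 ≤ C := (norm_nonneg _).trans (hj.2 x hx)
      positivity
    have hlipH : ∀ y ∈ ball x (r / 3), ‖H y - H x‖ ≤ L * ‖y - x‖ := by
      intro y hy
      refine le_of_tendsto (((hH y ?_).sub (hH x hx)).norm) ?_
      · exact hrb (ball_subset_ball (by linarith) hy)
      · filter_upwards [hlip] with j hj using hj y hy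
    refine ⟨ball x (min (r / 3) (ε / (3 * (L + 1)))),
      mem_nhdsWithin_of_mem_nhds (ball_mem_nhds _ (by positivity)), ?_⟩
    have hx' := (Metric.tendsto_nhds.1 (hH x hx)) (ε / 3) (by positivity)
    filter_upwards [hlip, hx'] with j hj hjx y hy
    have hy1 : y ∈ ball x (r / 3) := ball_subset_ball (min_le_left _ _) hy
    have hy2 : ‖y - x‖ < ε / (3 * (L + 1)) := by
      rw [← dist_eq_norm]; exact ball_subset_ball (min_le_right _ _) hy
    have hLε : L * ‖y - x‖ < ε / 3 := by
      rw [lt_div_iff₀ (by positivity)] at hy2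
      nlinarith [norm_nonneg (y - x)]
    have h1 := hj y hy1
    have h2 := hlipH y hy1
    rw [dist_eq_norm] at hjx ⊢
    have : H y - h j y = (H y - H x) - (h j y - h j x) - (h j x - H x) := by ring
    rw [this]
    calc _ ≤ ‖H y - H x‖ + ‖h j y - h j x‖ + ‖h j x - H x‖ :=
          (norm_sub_le _ _).trans (by gcongr; exact norm_sub_le _ _)
      _ < ε := by linarith
  have hd : ∀ᶠ j in (𝒰 : Filter ℕ), DifferentiableOn ℂ (h j) (ball p ρ) := hh.mono fun j hj => hj.1
  exact ⟨H, hloc.differentiableOn hd isOpen_ball, fun y hy => hH y hy,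
    fun y hy => (hloc.deriv hd isOpen_ball).tendsto_at hy⟩

/-- A density comparable to the Fubini-Study derivative of the curve with homogeneous
coordinates `g`. -/
noncomputable def projDensity {ι : Type*} [Fintype ι] (g : ι → ℂ → ℂ) (y : ℂ) : ℝ :=
  (∑ i, ∑ l, ‖g i y * deriv (g l) y - g l y * deriv (g i) y‖) / ∑ i, ‖g i y‖ ^ 2

section projDensity

variable {ι : Type*} [Fintype ι] {g : ι → ℂ → ℂ}

lemma sum_norm_sq_pos (hg0 : ∀ y, ∃ i, g i y ≠ 0) (y : ℂ) : 0 < ∑ i, ‖g i y‖ ^ 2 := by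
  obtain ⟨i, hi⟩ := hg0 y
  exact Finset.sum_pos' (fun _ _ => by positivity) ⟨i, Finset.mem_univ _, by positivity⟩

lemma projDensity_nonneg (y : ℂ) : 0 ≤ projDensity g y := by
  unfold projDensity; positivity

lemma continuous_projDensity (hg : ∀ i, Differentiable ℂ (g i)) (hg0 : ∀ y, ∃ i, g i y ≠ 0) :
    Continuous (projDensity g) := by
  have hc : ∀ i, Continuous (g i) := fun i => (hg i).continuous
  have hc' : ∀ i, Continuous (deriv (g i)) := fun i =>
    ((hg i).contDiff (n := 1)).continuous_deriv le_rfl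
  unfold projDensity
  exact Continuous.div (by fun_prop) (by fun_prop) fun y => (sum_norm_sq_pos hg0 y).ne'

lemma projDensity_comp_affine (hg : ∀ i, Differentiable ℂ (g i)) (a b y : ℂ) :
    projDensity (fun i x => g i (a + b * x)) y = ‖b‖ * projDensity g (a + b * y) := by
  have hd : ∀ i, deriv (fun x => g i (a + b * x)) y = b * deriv (g i) (a + b * y) := by
    intro i
    have h1 : HasDerivAt (fun x : ℂ => a + b * x) b y := by
      simpa using ((hasDerivAt_id y).const_mul b).const_add a
    have := (hg i (a + b * y)).hasDerivAt.comp y h1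
    rw [mul_comm]; exact this.deriv
  simp only [projDensity, hd]
  rw [← mul_div_assoc, Finset.mul_sum]
  congr 1
  refine Finset.sum_congr rfl fun i _ => ?_
  rw [Finset.mul_sum]
  refine Finset.sum_congr rfl fun l _ => ?_
  rw [← norm_mul]; congr 1; ring

/-- **Brody's reparametrization lemma** in homogeneous coordinates. -/
lemma exists_affine_reparametrization (hg : ∀ i, Differentiable ℂ (g i))
    (hg0 : ∀ y, ∃ i, g i y ≠ 0) {x₀ : ℂ} (hx₀ : projDensity g x₀ ≠ 0) {R : ℝ} (hR : 0 < R) :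
    ∃ a b : ℂ, projDensity (fun i x => g i (a + b * x)) 0 = 1 ∧
      ∀ y ∈ closedBall (0 : ℂ) R, projDensity (fun i x => g i (a + b * x)) y ≤ 2 := by
  have hD0 : 0 < projDensity g x₀ := lt_of_le_of_ne (projDensity_nonneg _) hx₀.symm
  set lam : ℝ := 2 * R / projDensity g x₀ with hlam
  have hlam0 : 0 < lam := by positivity
  set f : ι → ℂ → ℂ := fun i x => g i (x₀ + (lam : ℂ) * x) with hf
  have hfd : ∀ i, Differentiable ℂ (f i) := fun i => by
    have := hg i
    simp only [hf]; fun_prop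
  have hf0 : ∀ y, ∃ i, f i y ≠ 0 := fun y => hg0 _
  have hfD0 : projDensity f 0 = 2 * R := by
    rw [hf, projDensity_comp_affine hg]
    rw [mul_zero, add_zero, Complex.norm_real, Real.norm_eq_abs, abs_of_pos hlam0, hlam]
    field_simp
  have hcont := continuous_projDensity hfd hf0
  obtain ⟨x₁, hx₁, hmax⟩ := (isCompact_closedBall (0 : ℂ) 1).exists_isMaxOn
    ⟨0, by simp⟩ (f := fun x => (1 - ‖x‖) * projDensity f x)
    ((continuous_const.sub continuous_norm).mul hcont).continuousOn
  have hM : 2 * R ≤ (1 - ‖x₁‖) * projDensity f x₁ := by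
    have := hmax (show (0 : ℂ) ∈ closedBall (0 : ℂ) 1 by simp)
    simpa [hfD0] using this
  have hx₁1 : 0 ≤ 1 - ‖x₁‖ := by simpa using hx₁
  have hD1 : 0 < projDensity f x₁ := by
    by_contra h
    have : projDensity f x₁ = 0 := le_antisymm (not_lt.1 h) (projDensity_nonneg _)
    rw [this] at hM; linarith
  set c : ℝ := (projDensity f x₁)⁻¹ with hc
  have hc0 : 0 < c := by positivity
  have hkey : ∀ y, projDensity (fun i x => f i (x₁ + (c : ℂ) * x)) y
      = c * projDensity f (x₁ + c * y) := by
    intro y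
    rw [projDensity_comp_affine hfd]
    simp [abs_of_pos hc0]
  have hfg : (fun i x => g i ((x₀ + lam * x₁) + (lam * c : ℂ) * x))
      = fun i x => f i (x₁ + (c : ℂ) * x) := by
    funext i x
    simp only [hf]; congr 1; ring
  refine ⟨x₀ + lam * x₁, lam * c, ?_, ?_⟩
  · rw [hfg, hkey]; simp [hc, hD1.ne']
  · intro y hy
    rw [hfg, hkey]
    have hyR : ‖y‖ ≤ R := by simpa using hy
    have hRc : R * c ≤ (1 - ‖x₁‖) / 2 := by
      rw [hc, ← div_eq_mul_inv, div_le_iff₀ hD1]; linarith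
    have hn : ‖x₁ + c * y‖ ≤ ‖x₁‖ + R * c := by
      refine (norm_add_le _ _).trans ?_
      rw [norm_mul, Complex.norm_real, Real.norm_eq_abs, abs_of_pos hc0]
      nlinarith
    have h1 : (1 - ‖x₁‖) / 2 ≤ 1 - ‖x₁ + c * y‖ := by linarith
    have hpos : 0 < 1 - ‖x₁‖ := by
      by_contra h
      have : 1 - ‖x₁‖ = 0 := le_antisymm (not_lt.1 h) hx₁1
      rw [this] at hM; linarith
    have h2 := hmax (show x₁ + c * y ∈ closedBall (0 : ℂ) 1 by simp; linarith)
    simp only [mem_ofPred_eq] at h2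
    have h3 : (1 - ‖x₁‖) / 2 * projDensity f (x₁ + c * y) ≤ (1 - ‖x₁‖) * projDensity f x₁ :=
      (mul_le_mul_of_nonneg_right h1 (projDensity_nonneg _)).trans h2
    have h4 : projDensity f (x₁ + c * y) ≤ 2 * projDensity f x₁ := by
      nlinarith
    rw [hc, inv_mul_le_iff₀ hD1]; linarith

/-- A curve whose density vanishes identically is projectively constant. -/
lemma exists_eq_const_mul_of_projDensity_eq_zero (hg : ∀ i, Differentiable ℂ (g i))
    (hg0 : ∀ y, ∃ i, g i y ≠ 0) (hD : ∀ y, projDensity g y = 0) :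
    ∃ (c : ι → ℂ) (u : ℂ → ℂ), Differentiable ℂ u ∧ ∀ i z, g i z = c i * u z := by
  have hW : ∀ y i l, g i y * deriv (g l) y - g l y * deriv (g i) y = 0 := by
    intro y i l
    have h := hD y
    rw [projDensity, div_eq_zero_iff, or_iff_left (sum_norm_sq_pos hg0 y).ne'] at h
    have h1 := (Finset.sum_eq_zero_iff_of_nonneg fun i _ =>
      Finset.sum_nonneg fun l _ => norm_nonneg _).1 h i (Finset.mem_univ _)
    have h2 := (Finset.sum_eq_zero_iff_of_nonneg fun l _ => norm_nonneg _).1 h1 l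
      (Finset.mem_univ _)
    exact norm_eq_zero.1 h2
  obtain ⟨i, hi⟩ := hg0 0
  refine ⟨fun l => g l 0 / g i 0, g i, hg i, fun l z => ?_⟩
  have hnhds : ∀ᶠ y in 𝓝 (0 : ℂ), g i y ≠ 0 := (hg i).continuous.continuousAt.eventually_ne hi
  obtain ⟨r, hr, hrb⟩ := Metric.eventually_nhds_iff_ball.1 hnhds
  have hconst : ∀ y ∈ ball (0 : ℂ) r, g l y / g i y = g l 0 / g i 0 := by
    intro y hy
    refine (convex_ball (0 : ℂ) r).is_const_of_fderivWithin_eq_zero (𝕜 := ℂ)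
      (f := fun y => g l y / g i y) ?_ ?_ hy (mem_ball_self hr)
    · exact fun z hz => ((hg l z).div (hg i z) (hrb z hz)).differentiableWithinAt
    · intro z hz
      rw [fderivWithin_of_isOpen isOpen_ball hz]
      ext
      rw [fderiv_apply_one_eq_deriv, deriv_fun_div (hg l z) (hg i z) (hrb z hz)]
      simp only [zero_apply, div_eq_zero_iff]
      left
      linear_combination hW z i l
  have heq : (g l) =ᶠ[𝓝 0] fun z => g l 0 / g i 0 * g i z := by
    filter_upwards [ball_mem_nhds (0 : ℂ) hr] with y hy
    rw [← hconst y hy, div_mul_cancel₀ _ (hrb y hy)]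
  have := AnalyticOnNhd.eq_of_eventuallyEq (𝕜 := ℂ) (f := g l)
    (g := fun z => g l 0 / g i 0 * g i z) (fun z _ => (hg l).analyticAt z)
    (fun z _ => ((hg i).const_mul _).analyticAt z) heq
  exact congrFun this z

lemma norm_deriv_div_le (hg : ∀ i, Differentiable ℂ (g i)) {i : ι} {y : ℂ} (hi : g i y ≠ 0)
    (hle : ∀ l, ‖g l y‖ ≤ 2 * ‖g i y‖) (hD : projDensity g y ≤ 2) (l : ι) :
    ‖deriv (fun y => g l y / g i y) y‖ ≤ 8 * Fintype.card ι := by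
  rw [deriv_fun_div (hg l y) (hg i y) hi, norm_div, norm_pow, div_le_iff₀ (by positivity)]
  have hS : 0 < ∑ i, ‖g i y‖ ^ 2 :=
    Finset.sum_pos' (fun _ _ => by positivity) ⟨i, Finset.mem_univ _, by positivity⟩
  rw [projDensity, div_le_iff₀ hS] at hD
  have h1 : ‖g i y * deriv (g l) y - g l y * deriv (g i) y‖
      ≤ ∑ i, ∑ l, ‖g i y * deriv (g l) y - g l y * deriv (g i) y‖ :=
    (Finset.single_le_sum (f := fun l => ‖g i y * deriv (g l) y - g l y * deriv (g i) y‖)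
      (fun _ _ => norm_nonneg _) (Finset.mem_univ l)).trans
      (Finset.single_le_sum (f := fun i => ∑ l, ‖g i y * deriv (g l) y - g l y * deriv (g i) y‖)
        (fun _ _ => Finset.sum_nonneg fun _ _ => norm_nonneg _) (Finset.mem_univ i))
  have h2 : ∑ l, ‖g l y‖ ^ 2 ≤ Fintype.card ι * (4 * ‖g i y‖ ^ 2) := by
    rw [← nsmul_eq_mul]
    refine Finset.sum_le_card_nsmul _ _ _ fun l _ => ?_
    have := hle l
    nlinarith [norm_nonneg (g l y)]
  rw [mul_comm (deriv (g l) y)]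
  linarith

/-- A bound on the density keeps the curve inside an affine chart on discs of uniform radius. -/
lemma norm_le_two_mul_of_projDensity_le (hg : ∀ i, Differentiable ℂ (g i))
    (hg0 : ∀ y, ∃ i, g i y ≠ 0) {p : ℂ} {ρ : ℝ} (hρ : 16 * Fintype.card ι * ρ ≤ 1)
    (hD : ∀ y ∈ ball p ρ, projDensity g y ≤ 2) {i : ι} (hi : ∀ l, ‖g l p‖ ≤ ‖g i p‖) :
    ∀ y ∈ ball p ρ, ∀ l, ‖g l y‖ ≤ 2 * ‖g i y‖ := by
  intro y hy
  by_contra! hcon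
  obtain ⟨l₁, hl₁⟩ := hcon
  have hne : ∀ x, (∀ l, ‖g l x‖ ≤ 2 * ‖g i x‖) → g i x ≠ 0 := by
    intro x hx h
    obtain ⟨l, hl⟩ := hg0 x
    have := hx l
    rw [h, norm_zero, mul_zero] at this
    exact hl (norm_le_zero_iff.1 this)
  set γ : ℝ → ℂ := fun t => p + t * (y - p) with hγ
  have hγc : Continuous γ := by fun_prop
  set T : Set ℝ := {t | t ∈ Icc (0 : ℝ) 1 ∧ ∃ l, 2 * ‖g i (γ t)‖ ≤ ‖g l (γ t)‖} with hT
  have hTc : IsClosed T := by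
    have : T = Icc (0 : ℝ) 1 ∩ ⋃ l, {t | 2 * ‖g i (γ t)‖ ≤ ‖g l (γ t)‖} := by
      ext t; simp [hT]
    rw [this]
    refine isClosed_Icc.inter (isClosed_iUnion_of_finite fun l => isClosed_le ?_ ?_)
    · exact continuous_const.mul ((hg i).continuous.comp hγc).norm
    · exact ((hg l).continuous.comp hγc).norm
  have hTne : T.Nonempty := ⟨1, by simp, l₁, by simpa [hγ] using hl₁.le⟩
  have hTb : BddBelow T := ⟨0, fun t ht => ht.1.1⟩
  have hmem := hTc.csInf_mem hTne hTb
  set τ := sInf T with hτ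
  obtain ⟨⟨hτ0, hτ1⟩, l, hl⟩ := hmem
  have hlt : ∀ t ∈ Ico 0 τ, ∀ l, ‖g l (γ t)‖ ≤ 2 * ‖g i (γ t)‖ := by
    intro t ht l
    by_contra! h
    exact absurd (csInf_le hTb ⟨⟨ht.1, ht.2.le.trans hτ1⟩, l, h.le⟩) (not_le.2 ht.2)
  have hp : g i p ≠ 0 := hne p fun l => (hi l).trans (by linarith [norm_nonneg (g i p)])
  have hτpos : 0 < τ := by
    rcases hτ0.eq_or_lt with h | h
    · rw [← h] at hl
      simp only [hγ, Complex.ofReal_zero, zero_mul, add_zero] at hl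
      have := hi l
      have : 0 < ‖g i p‖ := norm_pos_iff.2 hp
      linarith
    · exact h
  have hle : ∀ t ∈ Icc 0 τ, ∀ l, ‖g l (γ t)‖ ≤ 2 * ‖g i (γ t)‖ := by
    intro t ht l
    rw [← closure_Ico hτpos.ne] at ht
    have hcl : IsClosed {t | ‖g l (γ t)‖ ≤ 2 * ‖g i (γ t)‖} :=
      isClosed_le ((hg l).continuous.comp hγc).norm
        (continuous_const.mul ((hg i).continuous.comp hγc).norm)
    exact closure_minimal (fun s hs => hlt s hs l) hcl ht
  have hγball : ∀ t ∈ Icc 0 τ, γ t ∈ ball p ρ := by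
    intro t ht
    rw [mem_ball, dist_eq_norm] at hy ⊢
    simp only [hγ, add_sub_cancel_left, norm_mul, Complex.norm_real, Real.norm_eq_abs,
      abs_of_nonneg ht.1]
    have : t ≤ 1 := ht.2.trans hτ1
    nlinarith [norm_nonneg (y - p)]
  have hρ0 : 0 < ρ := pos_of_mem_ball hy
  have hyp : ‖y - p‖ < ρ := by rwa [mem_ball, dist_eq_norm] at hy
  have hderiv : ∀ t ∈ Icc 0 τ, HasDerivAt (fun t => g l (γ t) / g i (γ t))
      (deriv (fun y => g l y / g i y) (γ t) * (y - p)) t := by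
    intro t ht
    have hd : DifferentiableAt ℂ (fun y => g l y / g i y) (γ t) :=
      (hg l _).div (hg i _) (hne _ (hle t ht))
    have h1 : HasDerivAt (fun t : ℝ => p + (t : ℂ) * (y - p)) (y - p) t := by
      simpa using (hasDerivAt_id t).ofReal_comp.mul_const (y - p)
    exact hd.hasDerivAt.comp t h1
  have hbound := norm_image_sub_le_of_norm_deriv_le_segment' (a := 0) (b := τ)
    (f := fun t => g l (γ t) / g i (γ t)) (C := 8 * Fintype.card ι * ρ)
    (fun t ht => (hderiv t ht).hasDerivWithinAt) (fun t ht => by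
      have htI := Ico_subset_Icc_self ht
      rw [norm_mul]
      have := norm_deriv_div_le hg (hne _ (hle t htI)) (hle t htI) (hD _ (hγball t htI)) l
      gcongr) τ (right_mem_Icc.2 hτ0)
  have h0 : ‖g l (γ 0) / g i (γ 0)‖ ≤ 1 := by
    simp only [hγ, Complex.ofReal_zero, zero_mul, add_zero]
    rw [norm_div, div_le_one (norm_pos_iff.2 hp)]
    exact hi l
  have hfin : ‖g l (γ τ) / g i (γ τ)‖ ≤ 3 / 2 := by
    have h3 := norm_sub_norm_le (g l (γ τ) / g i (γ τ)) (g l (γ 0) / g i (γ 0))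
    have : 8 * (Fintype.card ι : ℝ) * ρ * (τ - 0) ≤ 1 / 2 := by
      have : 0 ≤ 8 * (Fintype.card ι : ℝ) * ρ := by positivity
      nlinarith
    linarith
  have hiτ : 0 < ‖g i (γ τ)‖ := norm_pos_iff.2 (hne _ (hle τ (right_mem_Icc.2 hτ0)))
  rw [norm_div, div_le_iff₀ hiτ] at hfin
  linarith

end projDensity

lemma exists_entire_approx {L : ℂ → ℂ} {r R ε : ℝ} (hr : 0 ≤ r) (hrR : r < R) (hε : 0 < ε)
    (hL : DifferentiableOn ℂ L (ball 0 R)) :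
    ∃ Q : ℂ → ℂ, Differentiable ℂ Q ∧ ∀ y ∈ ball (0 : ℂ) r, ‖L y - Q y‖ ≤ ε := by
  obtain ⟨t, hrt, htR⟩ := exists_between hrR
  lift t to NNReal using hr.trans hrt.le
  lift r to NNReal using hr
  have hps := (hL.mono (closedBall_subset_ball htR)).hasFPowerSeriesOnBall
    (lt_of_le_of_lt r.2 hrt)
  have hu := hps.tendstoUniformlyOn (r' := r) (by exact_mod_cast hrt)
  rw [Metric.tendstoUniformlyOn_iff] at hu
  obtain ⟨n, hn⟩ := (hu ε hε).exists
  refine ⟨(cauchyPowerSeries L 0 t).partialSum n, ?_, fun y hy => ?_⟩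
  · unfold FormalMultilinearSeries.partialSum
    simp only [FormalMultilinearSeries.apply_eq_prod_smul_coeff, Finset.prod_const, Finset.card_univ,
      Fintype.card_fin]
    fun_prop
  · have := hn y hy
    rw [zero_add, dist_eq_norm] at this
    exact this.le

/-- **Weierstrass' theorem**: there is an entire function with prescribed zeros. -/
lemma exists_entire_analyticOrderAt_eq (d : ℂ → ℕ) (hd : ∀ p, ∀ᶠ y in 𝓝[≠] p, d y = 0) :
    ∃ s : ℂ → ℂ, Differentiable ℂ s ∧ ∀ p, analyticOrderAt s p = d p := by
  classical
  have hfin : ∀ N : ℕ, {a : ℂ | d a ≠ 0 ∧ ⌊‖a‖⌋₊ = N}.Finite := by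
    intro N
    by_contra hinf
    obtain ⟨p, -, hp⟩ := Set.Infinite.exists_accPt_of_subset_isCompact hinf
      (isCompact_closedBall (0 : ℂ) (N + 1)) (fun a ha => by
        rw [mem_closedBall_zero_iff, ← ha.2]
        exact (Nat.lt_floor_add_one _).le)
    rw [accPt_iff_frequently] at hp
    have h2 := eventually_nhdsWithin_iff.1 (hd p)
    exact hp (h2.mono fun y hy hh => hh.2.1 (hy hh.1))
  set A : ℕ → Finset ℂ := fun N => (hfin N).toFinset with hA
  have hAmem : ∀ N a, a ∈ A N ↔ d a ≠ 0 ∧ ⌊‖a‖⌋₊ = N := by simp [hA]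
  have hAnorm : ∀ N, ∀ a ∈ A N, (N : ℝ) ≤ ‖a‖ := fun N a ha => by
    rw [← ((hAmem N a).1 ha).2]; exact Nat.floor_le (norm_nonneg _)
  set L : ℕ → ℂ → ℂ := fun N y => ∑ a ∈ A N, d a * Complex.log (1 - y / a) with hLdef
  set lin : ℕ → ℂ → ℂ → ℂ := fun N a y => if N = 0 then y - a else 1 - y / a with hlin
  have hslit : ∀ N, ∀ a ∈ A N, ∀ y ∈ ball (0 : ℂ) N, 1 - y / a ∈ Complex.slitPlane := by
    intro N a ha y hy
    have hyN : ‖y‖ < N := by simpa using hy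
    have haN := hAnorm N a ha
    have ha0 : 0 < ‖a‖ := (norm_nonneg y).trans_lt (hyN.trans_le haN)
    rw [sub_eq_add_neg]
    refine Complex.mem_slitPlane_of_norm_lt_one ?_
    rw [norm_neg, norm_div, div_lt_one ha0]
    exact hyN.trans_le haN
  have hLd : ∀ N, DifferentiableOn ℂ (L N) (ball 0 N) := by
    intro N
    refine DifferentiableOn.fun_sum fun a ha => ?_
    refine (differentiableOn_const _).mul (DifferentiableOn.clog (by fun_prop) ?_)
    exact fun y hy => hslit N a ha y hy
  have hQ : ∀ N : ℕ, ∃ Q : ℂ → ℂ, Differentiable ℂ Q ∧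
      (N ≠ 0 → ∀ y ∈ ball (0 : ℂ) (N / 2), ‖L N y - Q y‖ ≤ (1 / 2) ^ N) := by
    intro N
    by_cases hN : N = 0
    · exact ⟨0, by fun_prop, fun h => absurd hN h⟩
    · have : (0 : ℝ) < N := by positivity
      obtain ⟨Q, h1, h2⟩ := exists_entire_approx (r := N / 2) (ε := (1 / 2) ^ N) (by positivity)
        (by linarith) (by positivity) (hLd N)
      exact ⟨Q, h1, fun _ => h2⟩
  choose Q hQd hQb using hQ
  set f : ℕ → ℂ → ℂ := fun N y => (∏ a ∈ A N, lin N a y ^ d a) * Complex.exp (-Q N y) with hf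
  have hlind : ∀ N a, Differentiable ℂ (lin N a) := by
    intro N a
    simp only [hlin]
    split_ifs <;> fun_prop
  have hfd : ∀ N, Differentiable ℂ (f N) := by
    intro N
    have := hQd N
    refine Differentiable.mul (Differentiable.fun_finsetProd fun a _ => (hlind N a).pow _) ?_
    fun_prop
  have hfexp : ∀ N : ℕ, N ≠ 0 → ∀ y ∈ ball (0 : ℂ) N, f N y = Complex.exp (L N y - Q N y) := by
    intro N hN y hy
    simp only [hf, hLdef, hlin, if_neg hN]
    rw [sub_eq_add_neg, Complex.exp_add, Complex.exp_sum]
    congr 1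
    refine Finset.prod_congr rfl fun a ha => ?_
    rw [Complex.exp_nat_mul, Complex.exp_log (Complex.slitPlane_ne_zero (hslit N a ha y hy))]
  set T : ℕ → ℂ → ℂ := fun M y => ∑' N, (L (N + M) y - Q (N + M) y) with hT
  have hTb : ∀ M : ℕ, M ≠ 0 → ∀ N : ℕ, ∀ y ∈ ball (0 : ℂ) (M / 2),
      ‖L (N + M) y - Q (N + M) y‖ ≤ (1 / 2) ^ N := by
    intro M hM N y hy
    refine (hQb (N + M) (by omega) y (ball_subset_ball ?_ hy)).trans ?_
    · push_cast; linarith [(Nat.cast_nonneg N : (0 : ℝ) ≤ N)]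
    · exact pow_le_pow_of_le_one (by norm_num) (by norm_num) (by omega)
  have hgeo : Summable fun N : ℕ => ((1 : ℝ) / 2) ^ N := summable_geometric_two
  have hTd : ∀ M : ℕ, M ≠ 0 → DifferentiableOn ℂ (T M) (ball 0 (M / 2)) := by
    intro M hM
    refine Complex.differentiableOn_tsum_of_summable_norm hgeo (fun N => ?_) isOpen_ball (hTb M hM)
    refine ((hLd (N + M)).mono (ball_subset_ball ?_)).sub (hQd _).differentiableOn
    push_cast; linarith [(Nat.cast_nonneg N : (0 : ℝ) ≤ N), (Nat.cast_nonneg M : (0 : ℝ) ≤ M)]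
  have hTsucc : ∀ M : ℕ, M ≠ 0 → ∀ y ∈ ball (0 : ℂ) (M / 2),
      T M y = (L M y - Q M y) + T (M + 1) y := by
    intro M hM y hy
    simp only [hT]
    rw [Summable.tsum_eq_zero_add (Summable.of_norm_bounded hgeo fun N => hTb M hM N y hy)]
    simp only [zero_add]
    congr 1
    refine tsum_congr fun N => ?_
    rw [show N + 1 + M = N + (M + 1) by ring]
  set S : ℕ → ℂ → ℂ := fun M y => (∏ N ∈ Finset.range M, f N y) * Complex.exp (T M y) with hS
  have hSsucc : ∀ M : ℕ, M ≠ 0 → ∀ y ∈ ball (0 : ℂ) (M / 2), S (M + 1) y = S M y := by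
    intro M hM y hy
    simp only [hS]
    rw [Finset.prod_range_succ, hTsucc M hM y hy, Complex.exp_add, hfexp M hM y
      (ball_subset_ball (by linarith [(Nat.cast_nonneg M : (0 : ℝ) ≤ M)]) hy)]
    ring
  set s : ℂ → ℂ := fun y => S (⌊2 * ‖y‖⌋₊ + 1) y with hs
  have hsS : ∀ M : ℕ, ∀ y ∈ ball (0 : ℂ) (M / 2), s y = S M y := by
    intro M y hy
    have hyM : 2 * ‖y‖ < M := by
      have : ‖y‖ < M / 2 := by simpa using hy
      linarith
    have hle : ⌊2 * ‖y‖⌋₊ + 1 ≤ M := (Nat.floor_lt (by positivity)).2 hyM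
    refine (Nat.le_induction (m := ⌊2 * ‖y‖⌋₊ + 1) (P := fun M _ => S M y = s y) rfl ?_ M hle).symm
    intro K hK hSK
    rw [hSsucc K (by omega) y ?_, hSK]
    rw [mem_ball_zero_iff]
    have h1 : ((⌊2 * ‖y‖⌋₊ + 1 : ℕ) : ℝ) ≤ K := by exact_mod_cast hK
    have h2 := Nat.lt_floor_add_one (2 * ‖y‖)
    push_cast at h1
    linarith
  have hball : ∀ p : ℂ, ∃ M : ℕ, M ≠ 0 ∧ p ∈ ball (0 : ℂ) (M / 2) ∧ ⌊‖p‖⌋₊ < M := by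
    intro p
    refine ⟨⌊2 * ‖p‖⌋₊ + 1, by omega, ?_, ?_⟩
    · rw [mem_ball_zero_iff]
      have h2 := Nat.lt_floor_add_one (2 * ‖p‖)
      push_cast; linarith
    · have : ⌊‖p‖⌋₊ ≤ ⌊2 * ‖p‖⌋₊ := Nat.floor_mono (by linarith [norm_nonneg p])
      omega
  have hloc : ∀ p : ℂ, ∃ M : ℕ, M ≠ 0 ∧ s =ᶠ[𝓝 p] S M ∧ ⌊‖p‖⌋₊ < M ∧
      AnalyticAt ℂ (T M) p := by
    intro p
    obtain ⟨M, hM, hp, hlt⟩ := hball p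
    refine ⟨M, hM, ?_, hlt, (hTd M hM).analyticAt (isOpen_ball.mem_nhds hp)⟩
    filter_upwards [isOpen_ball.mem_nhds hp] with y hy using hsS M y hy
  refine ⟨s, fun p => ?_, fun p => ?_⟩
  · obtain ⟨M, hM, hsM, -, hTa⟩ := hloc p
    refine DifferentiableAt.congr_of_eventuallyEq ?_ hsM
    refine DifferentiableAt.mul ?_ hTa.differentiableAt.cexp
    exact (Differentiable.fun_finsetProd fun N _ => hfd N).differentiableAt
  · obtain ⟨M, hM, hsM, hlt, hTa⟩ := hloc p
    rw [analyticOrderAt_congr hsM]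
    have hlina : ∀ N a, AnalyticAt ℂ (lin N a) p := fun N a => (hlind N a).analyticAt p
    have hlino : ∀ N, ∀ a ∈ A N, analyticOrderAt (lin N a) p = if a = p then 1 else 0 := by
      intro N a ha
      split_ifs with hap
      · subst hap
        refine ((hlina N a).analyticOrderAt_eq_natCast (n := 1)).2 ?_
        by_cases hN : N = 0
        · exact ⟨fun _ => 1, analyticAt_const, one_ne_zero, by simp [hlin, hN]⟩
        · have ha0 : a ≠ 0 := by
            rintro rfl
            have := hAnorm N 0 ha
            simp at this; exact hN this
          refine ⟨fun _ => -a⁻¹, analyticAt_const, by simpa using ha0, ?_⟩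
          refine Eventually.of_forall fun y => ?_
          simp only [hlin, if_neg hN, smul_eq_mul]
          field_simp
          ring
      · rw [(hlina N a).analyticOrderAt_eq_zero]
        by_cases hN : N = 0
        · simp only [hlin, if_pos hN]
          exact sub_ne_zero.2 (Ne.symm hap)
        · have ha0 : a ≠ 0 := by
            rintro rfl
            have := hAnorm N 0 ha
            simp at this; exact hN this
          simp only [hlin, if_neg hN]
          rw [sub_ne_zero]
          intro h
          rw [eq_div_iff ha0, one_mul] at h
          exact hap h
    have hexp : ∀ g : ℂ → ℂ, AnalyticAt ℂ g p → 
        analyticOrderAt (fun y => Complex.exp (g y)) p = 0 := by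
      intro g hg
      have h := hg.cexp
      refine AnalyticAt.analyticOrderAt_eq_zero h |>.2 ?_
      exact Complex.exp_ne_zero _
    have hprod : ∀ {α : Type} (t : Finset α) (F : α → ℂ → ℂ), (∀ a, AnalyticAt ℂ (F a) p) →
        analyticOrderAt (fun y => ∏ a ∈ t, F a y) p = ∑ a ∈ t, analyticOrderAt (F a) p := by
      intro α t F hF
      induction t using Finset.induction_on with
      | empty =>
        simp only [Finset.prod_empty, Finset.sum_empty]
        exact (analyticAt_const (𝕜 := ℂ)).analyticOrderAt_eq_zero.2 one_ne_zero
      | insert a t ha ih =>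
        simp only [Finset.prod_insert ha, Finset.sum_insert ha]
        rw [← ih]
        exact analyticOrderAt_mul (hF a) (Finset.analyticAt_fun_prod _ fun a _ => hF a)
    have hlinp : ∀ N, AnalyticAt ℂ (fun y => ∏ a ∈ A N, lin N a y ^ d a) p := fun N =>
      Finset.analyticAt_fun_prod _ fun a _ => (hlina N a).pow _
    have hfo : ∀ N, analyticOrderAt (f N) p = ∑ a ∈ A N, if a = p then (d p : ℕ∞) else 0 := by
      intro N
      have hQa : AnalyticAt ℂ (fun y => -Q N y) p := ((hQd N).analyticAt p).neg
      have h1 : analyticOrderAt (f N) p = _ := analyticOrderAt_mul (hlinp N) hQa.cexp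
      rw [h1]
      rw [hexp _ hQa, add_zero, hprod _ (fun a y => lin N a y ^ d a) fun a => (hlina N a).pow _]
      refine Finset.sum_congr rfl fun a ha => ?_
      have h3 : analyticOrderAt (fun y => lin N a y ^ d a) p = _ :=
        analyticOrderAt_pow (hlina N a) (d a)
      rw [h3, hlino N a ha]
      split_ifs with h
      · simp [h]
      · simp
    have h1 : analyticOrderAt (S M) p = _ :=
      analyticOrderAt_mul (Finset.analyticAt_fun_prod (Finset.range M)
        fun N _ => (hfd N).analyticAt p) hTa.cexp
    rw [h1]
    rw [show analyticOrderAt (fun y => Complex.exp (T M y)) p = 0 from hexp _ hTa, add_zero, hprod _ _ fun N => (hfd N).analyticAt p]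
    simp only [hfo, Finset.sum_ite_eq']
    by_cases hdp : d p = 0
    · simp [hdp]
    · rw [Finset.sum_eq_single ⌊‖p‖⌋₊]
      · simp [hAmem, hdp]
      · intro N _ hN
        rw [if_neg]
        exact fun h => hN ((hAmem N p).1 h).2.symm
      · simp [hlt]

/-- A holomorphic map from `ℂ` to projective space, given by compatible local tuples without common
zeros, lifts to a tuple of entire functions without common zeros. -/
lemma exists_entire_lift {ι : Type*} [Finite ι] {K : ℂ → ι → ℂ → ℂ}
    (hK : ∀ p i, AnalyticAt ℂ (K p i) p) (hK0 : ∀ p, ∃ i, K p i p ≠ 0)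
    (hc : ∀ p, ∀ᶠ x in 𝓝 p, ∀ᶠ y in 𝓝 x, ∀ i l, K p i y * K x l y = K p l y * K x i y) :
    ∃ Z : ι → ℂ → ℂ, (∀ i, Differentiable ℂ (Z i)) ∧ (∀ y, ∃ i, Z i y ≠ 0) ∧
      ∀ p, ∃ κ : ℂ → ℂ, κ p ≠ 0 ∧ ∀ᶠ y in 𝓝 p, ∀ i, Z i y = κ y * K p i y := by
  obtain ⟨i₀, hi₀⟩ := hK0 0
  have hpt : ∀ p, ∀ᶠ x in 𝓝 p, ∀ i l, K p i x * K x l x = K p l x * K x i x := fun p =>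
    (hc p).mono fun x hx => hx.self_of_nhds
  have hne : ∀ p, (∀ᶠ y in 𝓝[≠] p, K p i₀ y ≠ 0) →
      ∀ᶠ x in 𝓝[≠] p, K x i₀ x ≠ 0 := by
    intro p hp
    filter_upwards [hp, nhdsWithin_le_nhds (hpt p)] with x hx1 hx2 h
    obtain ⟨l, hl⟩ := hK0 x
    have := hx2 i₀ l
    rw [h, mul_zero] at this
    exact (mul_ne_zero hx1 hl) this
  have hclopen : IsClopen {p | ∀ᶠ y in 𝓝 p, K p i₀ y = 0} := by
    constructor
    · rw [← isOpen_compl_iff, isOpen_iff_mem_nhds]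
      intro p hp
      have hp1 := ((hK p i₀).eventually_eq_zero_or_eventually_ne_zero).resolve_left hp
      have := eventually_nhdsWithin_iff.1 (hne p hp1)
      filter_upwards [this] with x hx
      by_cases hxp : x = p
      · rw [hxp]; exact hp
      · exact fun h => hx hxp h.self_of_nhds
    · rw [isOpen_iff_mem_nhds]
      intro p hp
      obtain ⟨l, hl⟩ := hK0 p
      filter_upwards [hc p, ((hK p l).continuousAt.eventually_ne hl).eventually_nhds,
        eventually_eventually_nhds.2 hp] with x h1 h2 h3
      filter_upwards [h1, h2, h3] with y h1 h2 h3
      have := h1 i₀ l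
      rw [h3, zero_mul] at this
      exact (mul_eq_zero.1 this.symm).resolve_left h2
  have hnz : ∀ p, ¬ ∀ᶠ y in 𝓝 p, K p i₀ y = 0 := by
    rcases isClopen_iff.1 hclopen with h | h
    · intro p hp
      have : p ∈ {p | ∀ᶠ y in 𝓝 p, K p i₀ y = 0} := hp
      rw [h] at this
      exact this
    · have : (0 : ℂ) ∈ {p | ∀ᶠ y in 𝓝 p, K p i₀ y = 0} := by rw [h]; trivial
      exact absurd (Eventually.self_of_nhds this) hi₀
  have hfac : ∀ p, ∃ h : ℂ → ℂ, AnalyticAt ℂ h p ∧ h p ≠ 0 ∧ ∀ᶠ y in 𝓝 p,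
      K p i₀ y = (y - p) ^ (analyticOrderAt (K p i₀) p).toNat * h y := fun p => by
    have htop : analyticOrderAt (K p i₀) p ≠ ⊤ := fun h => hnz p (analyticOrderAt_eq_top.1 h)
    exact (hK p i₀).analyticOrderAt_ne_top.1 htop
  obtain ⟨s, hs, hso⟩ := exists_entire_analyticOrderAt_eq
    (fun p => (analyticOrderAt (K p i₀) p).toNat) (fun p => by
      filter_upwards [hne p (((hK p i₀).eventually_eq_zero_or_eventually_ne_zero).resolve_left
        (hnz p))] with y hy
      rw [(hK y i₀).analyticOrderAt_eq_zero.2 hy]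
      rfl)
  have hκ : ∀ p, ∃ κ : ℂ → ℂ, AnalyticAt ℂ κ p ∧ κ p ≠ 0 ∧
      ∀ᶠ y in 𝓝 p, s y = κ y * K p i₀ y := by
    intro p
    obtain ⟨h, ha, h0, hh⟩ := hfac p
    obtain ⟨g, ga, g0, hg⟩ := ((hs.analyticAt p).analyticOrderAt_eq_natCast).1 (hso p)
    refine ⟨fun y => g y / h y, ga.div ha h0, div_ne_zero g0 h0, ?_⟩
    filter_upwards [hh, hg, ha.continuousAt.eventually_ne h0] with y h1 h2 h3
    rw [h1, h2, smul_eq_mul]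
    field_simp
  choose κ hκa hκ0 hκs using hκ
  have hZ : ∀ p, ∀ᶠ y in 𝓝 p, ∀ i, κ y y * K y i y = κ p y * K p i y := by
    intro p
    have h1 := eventually_nhdsWithin_iff.1
      (((hK p i₀).eventually_eq_zero_or_eventually_ne_zero).resolve_left (hnz p))
    filter_upwards [h1, hpt p, hκs p] with x hx1 hx2 hx3 i
    by_cases hxp : x = p
    · rw [hxp]
    have hx4 := (hκs x).self_of_nhds
    have h5 := hx2 i₀ i
    apply mul_right_cancel₀ (hx1 hxp)
    linear_combination κ x x * h5 - K p i x * hx4 + K p i x * hx3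
  refine ⟨fun i y => κ y y * K y i y, fun i p => ?_, fun y => ?_, fun p => ⟨κ p, hκ0 p, hZ p⟩⟩
  · refine DifferentiableAt.congr_of_eventuallyEq ((hκa p).mul (hK p i)).differentiableAt ?_
    exact (hZ p).mono fun y hy => hy i
  · obtain ⟨i, hi⟩ := hK0 y
    exact ⟨i, mul_ne_zero (hκ0 y) hi⟩

/-- Cauchy-type bound for the roots of a polynomial. -/
lemma norm_le_of_pow_add_sum_eq {m n : ℕ} (hm : n < m) {v γ : ℂ} {b : Fin n → ℂ} {B : ℝ}
    (hb : ∀ i, ‖b i‖ ≤ B) (hγ : ‖γ‖ ≤ B) (h : v ^ m + ∑ i, b i * v ^ (i : ℕ) = γ) :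
    ‖v‖ ≤ max 1 ((n + 1) * B) := by
  by_contra! hlt
  obtain ⟨h1, h2⟩ := max_lt_iff.1 hlt
  have hB : 0 ≤ B := (norm_nonneg _).trans hγ
  have h3 : ‖v‖ ^ m ≤ B * ‖v‖ ^ (m - 1) + ∑ i : Fin n, B * ‖v‖ ^ (m - 1) := by
    rw [← norm_pow, eq_sub_of_add_eq h]
    refine (norm_sub_le _ _).trans (add_le_add ?_ (norm_sum_le_of_le _ fun i _ => ?_))
    · exact hγ.trans (le_mul_of_one_le_right hB (one_le_pow₀ h1.le))
    · rw [norm_mul, norm_pow]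
      have := i.2
      exact mul_le_mul (hb i) (pow_le_pow_right₀ h1.le (by omega)) (by positivity) hB
  rw [Finset.sum_const, Finset.card_univ, Fintype.card_fin, nsmul_eq_mul] at h3
  obtain ⟨m, rfl⟩ := Nat.exists_eq_add_of_le' (by omega : 1 ≤ m)
  rw [Nat.add_sub_cancel, pow_succ'] at h3
  have h4 : ‖v‖ * ‖v‖ ^ m ≤ ((n + 1) * B) * ‖v‖ ^ m := by linarith
  exact absurd (le_of_mul_le_mul_right h4 (by positivity)) (not_le.2 h2)

/-- Liouville's theorem off a discrete closed set. -/
lemma exists_eq_const_of_bounded_off_discrete {f : ℂ → ℂ} {T : Set ℂ} {C : ℝ}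
    (hT : ∀ p, ∀ᶠ y in 𝓝[≠] p, y ∉ T) (hf : ∀ y ∉ T, DifferentiableAt ℂ f y)
    (hC : ∀ y ∉ T, ‖f y‖ ≤ C) : ∃ c, ∀ y ∉ T, f y = c := by
  have hlim : ∀ p, ∃ F : ℂ → ℂ, DifferentiableAt ℂ F p ∧ ∀ᶠ y in 𝓝[≠] p, F y = f y := by
    intro p
    have hev := eventually_nhdsWithin_iff.1 (hT p)
    obtain ⟨U, hU, hpU, hUo⟩ := _root_.mem_nhds_iff.1 hev
    refine ⟨_, (Complex.differentiableOn_update_limUnder_of_bddAbove (f := f)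
      (hpU.mem_nhds hUo) ?_ ?_).differentiableAt (hpU.mem_nhds hUo), ?_⟩
    · exact fun y hy => (hf y (hU hy.1 hy.2)).differentiableWithinAt
    · refine ⟨C, ?_⟩
      rintro _ ⟨y, hy, rfl⟩
      exact hC y (hU hy.1 hy.2)
    · filter_upwards [self_mem_nhdsWithin] with y hy
      rw [Function.update_of_ne hy]
  choose F hFd hFe using hlim
  have hFp : ∀ p ∉ T, F p p = f p := by
    intro p hp
    have h1 : Tendsto (F p) (𝓝[≠] p) (𝓝 (F p p)) :=
      (hFd p).continuousAt.tendsto.mono_left nhdsWithin_le_nhds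
    have h2 : Tendsto f (𝓝[≠] p) (𝓝 (f p)) := (hf p hp).continuousAt.tendsto.mono_left nhdsWithin_le_nhds
    exact tendsto_nhds_unique (h1.congr' (hFe p)) h2
  have hG : ∀ p, (fun y => F y y) =ᶠ[𝓝 p] F p := by
    intro p
    have := eventually_nhdsWithin_iff.1 ((hT p).and (hFe p))
    filter_upwards [this] with y hy
    by_cases hyp : y = p
    · rw [hyp]
    · rw [hFp y (hy hyp).1, (hy hyp).2]
  have hGd : Differentiable ℂ fun y => F y y := fun p => (hFd p).congr_of_eventuallyEq (hG p)
  have hGb : Bornology.IsBounded (range fun y => F y y) := by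
    refine (isBounded_closedBall (x := (0 : ℂ)) (r := C)).subset ?_
    rintro _ ⟨p, rfl⟩
    rw [mem_closedBall_zero_iff]
    have h1 : Tendsto (fun y => F y y) (𝓝[≠] p) (𝓝 (F p p)) :=
      (hGd p).continuousAt.tendsto.mono_left nhdsWithin_le_nhds
    refine le_of_tendsto h1.norm ?_
    filter_upwards [hT p] with y hy
    rw [hFp y hy]
    exact hC y hy
  obtain ⟨c, hc⟩ := hGd.exists_eq_const_of_bounded hGb
  exact ⟨c, fun y hy => by rw [← hFp y hy]; exact congrFun hc y⟩

lemma Polynomial.exists_norm_eval_le_mul_max_pow (P : Polynomial ℂ) {m : ℕ} (hm : P.natDegree ≤ m) :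
    ∃ C : ℝ, 1 ≤ C ∧ ∀ z, ‖P.eval z‖ ≤ C * max 1 ‖z‖ ^ m := by
  refine ⟨1 + ∑ i ∈ Finset.range (P.natDegree + 1), ‖P.coeff i‖, ?_, fun z => ?_⟩
  · linarith [Finset.sum_nonneg fun i (_ : i ∈ Finset.range (P.natDegree + 1)) =>
      norm_nonneg (P.coeff i)]
  · rw [Polynomial.eval_eq_sum_range]
    have h1 : (1 : ℝ) ≤ max 1 ‖z‖ := le_max_left _ _
    calc _ ≤ ∑ i ∈ Finset.range (P.natDegree + 1), ‖P.coeff i‖ * max 1 ‖z‖ ^ m := by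
          refine norm_sum_le_of_le _ fun i hi => ?_
          have hi := Finset.mem_range.1 hi
          rw [norm_mul, norm_pow]
          gcongr
          exact (pow_le_pow_left₀ (norm_nonneg _) (le_max_right _ _) _).trans
            (pow_le_pow_right₀ h1 (by omega))
      _ ≤ _ := by
          rw [← Finset.sum_mul]
          gcongr
          linarith

lemma Polynomial.exists_mul_pow_le_norm_eval {P : Polynomial ℂ} (hP : P ≠ 0) {r : ℕ}
    (hr : r ≤ P.natDegree) :
    ∃ c > 0, ∃ R : ℝ, 1 ≤ R ∧ ∀ z, R ≤ ‖z‖ → c * ‖z‖ ^ r ≤ ‖P.eval z‖ := by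
  have hlc : 0 < ‖P.leadingCoeff‖ := norm_pos_iff.2 (leadingCoeff_ne_zero.2 hP)
  have hcont : ContinuousAt (fun w => ‖P.reverse.eval w‖) 0 := by
    have := P.reverse.continuous
    fun_prop
  have h0 : ‖P.reverse.eval 0‖ = ‖P.leadingCoeff‖ := by
    rw [← Polynomial.coeff_zero_eq_eval_zero, Polynomial.coeff_zero_reverse]
  have hev : ∀ᶠ w in 𝓝 (0 : ℂ), ‖P.leadingCoeff‖ / 2 < ‖P.reverse.eval w‖ :=
    hcont.eventually_const_lt (by simp only [h0]; linarith)
  obtain ⟨ε, hε, hball⟩ := Metric.eventually_nhds_iff.1 hev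
  refine ⟨‖P.leadingCoeff‖ / 2, by linarith, max 1 (2 / ε), le_max_left _ _, fun z hz => ?_⟩
  have hz1 : 1 ≤ ‖z‖ := (le_max_left _ _).trans hz
  have hz2 : 2 / ε ≤ ‖z‖ := (le_max_right _ _).trans hz
  have hz0 : z ≠ 0 := norm_pos_iff.1 (by linarith)
  have hinv : dist z⁻¹ 0 < ε := by
    rw [dist_zero_right, norm_inv, inv_lt_comm₀ (by linarith) hε]
    refine lt_of_lt_of_le ?_ hz2
    rw [inv_eq_one_div]
    gcongr
    norm_num
  have h1 := hball hinv
  have h2 : P.reverse.eval z⁻¹ * z ^ P.natDegree = P.eval z := by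
    let := invertibleOfNonzero hz0
    have := Polynomial.eval₂_reverse_mul_pow (RingHom.id ℂ) z P
    simpa [Polynomial.eval₂_id, invOf_eq_inv] using this
  rw [← h2, norm_mul, norm_pow]
  gcongr

lemma Polynomial.exists_coprime_factorization_derivative {q : Polynomial ℂ} {m d : ℕ} (hq : q ≠ 0)
    (hm : q.natDegree + d ≤ m) (hd : 1 ≤ d) :
    ∃ p₁ p₂ g A B : Polynomial ℂ, Polynomial.X ^ m + q = p₁ * g ∧
      derivative (Polynomial.X ^ m + q) = p₂ * g ∧ A * p₁ + B * p₂ = 1 ∧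
      d ≤ p₁.natDegree := by
  set p : Polynomial ℂ := Polynomial.X ^ m + q with hp
  have hqm : q.degree < (m : WithBot ℕ) :=
    (Polynomial.degree_le_natDegree).trans_lt (by exact_mod_cast (by omega))
  have hmon : p.Monic := Polynomial.monic_X_pow_add hqm
  have hdeg : p.natDegree = m := by
    rw [hp, Polynomial.natDegree_add_eq_left_of_degree_lt, Polynomial.natDegree_X_pow]
    rwa [Polynomial.degree_X_pow]
  have hp0 : p ≠ 0 := hmon.ne_zero
  set g := EuclideanDomain.gcd p (derivative p) with hg
  have hg0 : g ≠ 0 := fun h => hp0 ((EuclideanDomain.gcd_eq_zero_iff.1 h).1)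
  obtain ⟨p₁, h1⟩ := EuclideanDomain.gcd_dvd_left p (derivative p)
  obtain ⟨p₂, h2⟩ := EuclideanDomain.gcd_dvd_right p (derivative p)
  have hbez := EuclideanDomain.gcd_eq_gcd_ab p (derivative p)
  rw [← hg] at h1 h2 hbez
  have hgd : g.natDegree ≤ q.natDegree := by
    have hdvd : g ∣ Polynomial.C (m : ℂ) * q - Polynomial.X * derivative q := by
      have : Polynomial.C (m : ℂ) * q - Polynomial.X * derivative q
          = Polynomial.C (m : ℂ) * p - Polynomial.X * derivative p := by
        have hm1 : m = (m - 1) + 1 := by omega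
        rw [hp, derivative_add, derivative_X_pow]
        nth_rw 3 [hm1]
        rw [pow_succ']
        ring
      rw [this]
      exact dvd_sub (Dvd.dvd.mul_left ⟨p₁, h1⟩ _) (Dvd.dvd.mul_left ⟨p₂, h2⟩ _)
    have hcoeff : (Polynomial.C (m : ℂ) * q - Polynomial.X * derivative q).coeff q.natDegree
        = (m - q.natDegree : ℂ) * q.leadingCoeff := by
      rw [coeff_sub, coeff_C_mul]
      rcases hn : q.natDegree with _ | e
      · simp [leadingCoeff, hn]
      · rw [coeff_X_mul, coeff_derivative, leadingCoeff, hn]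
        push_cast
        ring
    have hne : Polynomial.C (m : ℂ) * q - Polynomial.X * derivative q ≠ 0 := by
      intro h
      rw [h, coeff_zero] at hcoeff
      rcases mul_eq_zero.1 hcoeff.symm with h | h
      · have : m = q.natDegree := by exact_mod_cast sub_eq_zero.1 h
        omega
      · exact hq (leadingCoeff_eq_zero.1 h)
    refine (natDegree_le_of_dvd hdvd hne).trans ?_
    refine (natDegree_sub_le _ _).trans (max_le (natDegree_C_mul_le _ _) ?_)
    rcases hn : q.natDegree with _ | e
    · rw [Polynomial.derivative_of_natDegree_zero hn]; simp
    · refine natDegree_mul_le.trans ?_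
      have := natDegree_derivative_le q
      rw [natDegree_X]; omega
  refine ⟨p₁, p₂, g, EuclideanDomain.gcdA p (derivative p), EuclideanDomain.gcdB p (derivative p),
    by rw [h1]; ring, by rw [h2]; ring, ?_, ?_⟩
  · apply mul_left_cancel₀ hg0
    linear_combination (-EuclideanDomain.gcdA p (derivative p)) * h1
      - EuclideanDomain.gcdB p (derivative p) * h2 - hbez
  · have hp1 : p₁ ≠ 0 := by rintro rfl; rw [mul_zero] at h1; exact hp0 h1
    have : p.natDegree = g.natDegree + p₁.natDegree := by
      conv_lhs => rw [h1]
      exact natDegree_mul hg0 hp1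
    omega

/-- The bound on the quantity `η` (and `w * η`) which makes it constant by Liouville's theorem. -/
lemma exists_norm_mul_le_of_pow_eq_eval {p p₁ : Polynomial ℂ} {A B : Polynomial ℂ} {k m : ℕ}
    (hk : 1 ≤ k) (hm : 1 ≤ m) (hp : p.natDegree ≤ m) (hp₁ : 4 ≤ p₁.natDegree) {C : ℝ} (hC : 0 ≤ C) :
    ∃ C' : ℝ, ∀ w w' f f' η : ℂ, w ^ (k * m) = p.eval f →
      (w ≠ 0 → p₁.eval f * η = w * f') →
      η = A.eval f * w * f' + (k * m : ℕ) * B.eval f * w' →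
      ‖f‖ ≤ C * max 1 ‖w‖ ^ k → ‖f'‖ ≤ C * max 1 ‖w‖ ^ (k + 1) → ‖w'‖ ≤ C * max 1 ‖w‖ ^ 2 →
      ‖η‖ ≤ C' ∧ ‖w * η‖ ≤ C' := by
  obtain ⟨D, hD1, hD⟩ := p.exists_norm_eval_le_mul_max_pow hp
  have hp₁0 : p₁ ≠ 0 := by rintro rfl; simp at hp₁
  obtain ⟨c, hc, R, hR1, hR⟩ := Polynomial.exists_mul_pow_le_norm_eval hp₁0 hp₁
  obtain ⟨DA, hDA1, hDA⟩ := A.exists_norm_eval_le_mul_max_pow le_rfl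
  obtain ⟨DB, hDB1, hDB⟩ := B.exists_norm_eval_le_mul_max_pow le_rfl
  set Λ := D * R with hΛ
  have hΛ1 : 1 ≤ Λ := one_le_mul_of_one_le_of_one_le hD1 hR1
  set Φ := max 1 (C * Λ ^ k) with hΦ
  set E := DA * Φ ^ A.natDegree * Λ * (C * Λ ^ (k + 1)) +
    (k * m : ℕ) * (DB * Φ ^ B.natDegree) * (C * Λ ^ 2) with hE
  have hE0 : 0 ≤ E := by positivity
  refine ⟨max (Λ * E) (C * D ^ 4 / c), fun w w' f f' η h1 h2 h3 h4 h5 h6 => ?_⟩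
  by_cases hw : ‖w‖ ≤ Λ
  · have hMw : max 1 ‖w‖ ≤ Λ := max_le hΛ1 hw
    have hf : max 1 ‖f‖ ≤ Φ := by
      refine max_le_max le_rfl (h4.trans ?_)
      gcongr
    have hη : ‖η‖ ≤ E := by
      rw [h3]
      refine (norm_add_le _ _).trans (add_le_add ?_ ?_)
      · rw [norm_mul, norm_mul]
        gcongr
        · exact (hDA f).trans (by gcongr)
        · exact h5.trans (by gcongr)
      · rw [norm_mul, norm_mul, Complex.norm_natCast]
        gcongr
        · exact (hDB f).trans (by gcongr)
        · exact h6.trans (by gcongr)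
    refine ⟨le_max_of_le_left (hη.trans ?_), le_max_of_le_left ?_⟩
    · exact le_mul_of_one_le_left hE0 hΛ1
    · rw [norm_mul]; gcongr
  · push Not at hw
    have hw1 : 1 < ‖w‖ := hΛ1.trans_lt hw
    have hMw : max 1 ‖w‖ = ‖w‖ := max_eq_right hw1.le
    rw [hMw] at h4 h5 h6
    have h7 : ‖w‖ ^ k ≤ D * max 1 ‖f‖ := by
      refine le_of_pow_le_pow_left₀ (n := m) (by omega) (by positivity) ?_
      rw [← pow_mul, ← norm_pow, h1, mul_pow]
      refine (hD f).trans ?_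
      gcongr
      exact le_self_pow₀ hD1 (by omega)
    have h8 : R < max 1 ‖f‖ := by
      have : ‖w‖ ≤ ‖w‖ ^ k := le_self_pow₀ hw1.le (by omega)
      exact lt_of_mul_lt_mul_left (hw.trans_le (this.trans h7)) (by positivity)
    have hf1 : max 1 ‖f‖ = ‖f‖ := by
      rcases max_choice 1 ‖f‖ with h | h
      · rw [h] at h8; linarith
      · exact h
    rw [hf1] at h7 h8
    have h9 := hR f h8.le
    have h10 : c * (‖w‖ ^ k) ^ 4 ≤ D ^ 4 * ‖p₁.eval f‖ := by
      calc c * (‖w‖ ^ k) ^ 4 ≤ c * (D * ‖f‖) ^ 4 := by gcongr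
        _ = D ^ 4 * (c * ‖f‖ ^ 4) := by ring
        _ ≤ _ := by gcongr
    have h11 : ‖p₁.eval f‖ * ‖w * η‖ ≤ C * ‖w‖ ^ (k * 4) := by
      calc ‖p₁.eval f‖ * ‖w * η‖ = ‖w‖ * ‖p₁.eval f * η‖ := by simp only [norm_mul]; ring
        _ = ‖w‖ * (‖w‖ * ‖f'‖) := by rw [h2 (norm_pos_iff.1 (by linarith)), norm_mul]
        _ ≤ ‖w‖ * (‖w‖ * (C * ‖w‖ ^ (k + 1))) := by gcongr
        _ = C * ‖w‖ ^ (k + 3) := by ring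
        _ ≤ _ := by
          gcongr
          · exact hw1.le
          · omega
    have h12 : ‖w * η‖ ≤ C * D ^ 4 / c := by
      rw [le_div_iff₀ hc]
      have hpos : 0 < ‖w‖ ^ (k * 4) := by positivity
      refine le_of_mul_le_mul_right ?_ hpos
      calc ‖w * η‖ * c * ‖w‖ ^ (k * 4) = c * (‖w‖ ^ k) ^ 4 * ‖w * η‖ := by ring
        _ ≤ D ^ 4 * ‖p₁.eval f‖ * ‖w * η‖ := by gcongr
        _ = D ^ 4 * (‖p₁.eval f‖ * ‖w * η‖) := by ring
        _ ≤ D ^ 4 * (C * ‖w‖ ^ (k * 4)) := by gcongr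
        _ = _ := by ring
    refine ⟨le_max_of_le_right (le_trans ?_ h12), le_max_of_le_right h12⟩
    rw [norm_mul]
    exact le_mul_of_one_le_left (norm_nonneg _) hw1.le

/-- A solution of `ω ^ (k * m) = φ ^ m + q(φ)` by meromorphic functions on `ℂ` which is a Brody curve
has constant `ω`, provided `deg q + 4 ≤ m`. -/
lemma deriv_eq_zero_of_pow_eq_eval {q : Polynomial ℂ} {k m : ℕ} (hk : 1 ≤ k) (hq : q ≠ 0)
    (hm : q.natDegree + 4 ≤ m) {ω φ : ℂ → ℂ} {T : Set ℂ} (hT : ∀ p, ∀ᶠ y in 𝓝[≠] p, y ∉ T)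
    (hω : ∀ y ∉ T, DifferentiableAt ℂ ω y) (hφ : ∀ y ∉ T, DifferentiableAt ℂ φ y)
    (h : ∀ y ∉ T, ω y ^ (k * m) = φ y ^ m + q.eval (φ y)) {C : ℝ}
    (h1 : ∀ y ∉ T, ‖φ y‖ ≤ C * max 1 ‖ω y‖ ^ k)
    (h2 : ∀ y ∉ T, ‖deriv φ y‖ ≤ C * max 1 ‖ω y‖ ^ (k + 1))
    (h3 : ∀ y ∉ T, ‖deriv ω y‖ ≤ C * max 1 ‖ω y‖ ^ 2) : ∀ y ∉ T, deriv ω y = 0 := by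
  intro y₀ hy₀
  have hC : 0 ≤ C := by
    by_contra! hC
    have := (norm_nonneg _).trans (h1 y₀ hy₀)
    have h4 : 0 < max 1 ‖ω y₀‖ ^ k := by positivity
    nlinarith
  have hTn : ∀ y ∉ T, ∀ᶠ x in 𝓝 y, x ∉ T := by
    intro y hy
    filter_upwards [eventually_nhdsWithin_iff.1 (hT y)] with x hx
    by_cases hxy : x = y
    · rwa [hxy]
    · exact hx hxy
  have han : ∀ f : ℂ → ℂ, (∀ y ∉ T, DifferentiableAt ℂ f y) → ∀ y ∉ T, AnalyticAt ℂ f y :=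
    fun f hf y hy => Complex.analyticAt_iff_eventually_differentiableAt.2 ((hTn y hy).mono hf)
  have hωa := han ω hω
  have hφa := han φ hφ
  obtain ⟨p₁, p₂, g, A, B, e1, e2, e3, hp₁⟩ :=
    Polynomial.exists_coprime_factorization_derivative hq hm (by norm_num)
  set p : Polynomial ℂ := Polynomial.X ^ m + q with hp
  have hpe : ∀ y ∉ T, ω y ^ (k * m) = p.eval (φ y) := fun y hy => by
    rw [h y hy, hp]; simp
  have hpdeg : p.natDegree ≤ m := by
    refine (Polynomial.natDegree_add_le _ _).trans (max_le ?_ (by omega))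
    rw [Polynomial.natDegree_X_pow]
  have hrel : ∀ y ∉ T, ω y ≠ 0 → p₁.eval (φ y) ≠ 0 ∧
      p₂.eval (φ y) * deriv φ y * ω y = (k * m : ℕ) * p₁.eval (φ y) * deriv ω y := by
    intro y hy hy0
    have hne : p₁.eval (φ y) * g.eval (φ y) ≠ 0 := by
      rw [← Polynomial.eval_mul, ← e1, ← hpe y hy]
      exact pow_ne_zero _ hy0
    refine ⟨left_ne_zero_of_mul hne, ?_⟩
    have hd1 : HasDerivAt (fun x => ω x ^ (k * m)) _ y := (hω y hy).hasDerivAt.pow (k * m)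
    have hd2 : HasDerivAt (fun x => p.eval (φ x)) (p.derivative.eval (φ y) * deriv φ y) y :=
      (p.hasDerivAt (φ y)).comp y (hφ y hy).hasDerivAt
    have hee : (fun x => ω x ^ (k * m)) =ᶠ[𝓝 y] fun x => p.eval (φ x) :=
      (hTn y hy).mono hpe
    have hd3 := hd1.unique (hd2.congr_of_eventuallyEq hee)
    apply mul_right_cancel₀ (right_ne_zero_of_mul hne)
    have e1' : ω y ^ (k * m) = p₁.eval (φ y) * g.eval (φ y) := by
      rw [hpe y hy, e1, Polynomial.eval_mul]
    rw [e2, Polynomial.eval_mul] at hd3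
    have hpow : ω y ^ (k * m) = ω y ^ (k * m - 1) * ω y := by
      rw [← pow_succ, Nat.sub_add_cancel (Nat.mul_pos hk (by omega))]
    rw [hpow] at e1'
    linear_combination (-ω y) * hd3 + (k * m : ℕ) * deriv ω y * e1'
  have he3 : ∀ z : ℂ, A.eval z * p₁.eval z + B.eval z * p₂.eval z = 1 := fun z => by
    simpa using congrArg (Polynomial.eval z) e3
  set η : ℂ → ℂ := fun y => A.eval (φ y) * ω y * deriv φ y +
    (k * m : ℕ) * B.eval (φ y) * deriv ω y with hη
  have hηrel : ∀ y ∉ T, ω y ≠ 0 → p₁.eval (φ y) * η y = ω y * deriv φ y := by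
    intro y hy hy0
    obtain ⟨-, h5⟩ := hrel y hy hy0
    simp only [hη]
    linear_combination (-B.eval (φ y)) * h5 + ω y * deriv φ y * he3 (φ y)
  obtain ⟨C', hC'⟩ := exists_norm_mul_le_of_pow_eq_eval (A := A) (B := B) hk
    (by omega : 1 ≤ m) hpdeg hp₁ hC
  have hb : ∀ y ∉ T, ‖η y‖ ≤ C' ∧ ‖ω y * η y‖ ≤ C' := fun y hy =>
    hC' _ _ _ _ _ (hpe y hy) (hηrel y hy) rfl (h1 y hy) (h2 y hy) (h3 y hy)
  have hηd : ∀ y ∉ T, DifferentiableAt ℂ η y := by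
    intro y hy
    have d1 := (hωa y hy).deriv.differentiableAt
    have d2 := (hφa y hy).deriv.differentiableAt
    have d3 := hω y hy
    have d4 := hφ y hy
    have d5 : DifferentiableAt ℂ (fun x => A.eval (φ x)) y :=
      A.differentiable.differentiableAt.comp y d4
    have d6 : DifferentiableAt ℂ (fun x => B.eval (φ x)) y :=
      B.differentiable.differentiableAt.comp y d4
    fun_prop
  obtain ⟨c₁, hc₁⟩ := exists_eq_const_of_bounded_off_discrete hT hηd fun y hy => (hb y hy).1
  obtain ⟨c₂, hc₂⟩ := exists_eq_const_of_bounded_off_discrete (f := fun y => ω y * η y) hT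
    (fun y hy => (hω y hy).mul (hηd y hy)) fun y hy => (hb y hy).2
  by_cases hc : c₁ = 0
  · have hz : ∀ y ∉ T, ω y ≠ 0 → deriv ω y = 0 := by
      intro y hy hy0
      obtain ⟨h5, h6⟩ := hrel y hy hy0
      have h7 := hηrel y hy hy0
      rw [hc₁ y hy, hc, mul_zero] at h7
      have h8 : deriv φ y = 0 := (mul_eq_zero.1 h7.symm).resolve_left hy0
      rw [h8, mul_zero, zero_mul] at h6
      refine (mul_eq_zero.1 h6.symm).resolve_left (mul_ne_zero ?_ h5)
      exact_mod_cast (Nat.mul_pos hk (by omega)).ne'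
    by_contra hne
    have h5 : ∀ᶠ y in 𝓝 y₀, ω y = 0 := by
      filter_upwards [hTn y₀ hy₀, (hωa y₀ hy₀).deriv.continuousAt.eventually_ne hne] with y h5 h6
      by_contra h7
      exact h6 (hz y h5 h7)
    have h6 : ω =ᶠ[𝓝 y₀] fun _ => 0 := h5
    rw [h6.deriv_eq, deriv_const] at hne
    exact hne rfl
  · have h5 : ω =ᶠ[𝓝 y₀] fun _ => c₂ / c₁ := by
      filter_upwards [hTn y₀ hy₀] with y hy
      rw [eq_div_iff hc, ← hc₂ y hy, hc₁ y hy]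
    rw [h5.deriv_eq, deriv_const]

lemma MvPolynomial.IsHomogeneous.eval_mul_left {ι : Type*} [Fintype ι] {P : MvPolynomial ι ℂ} {d : ℕ}
    (hP : P.IsHomogeneous d) (t : ℂ) (x : ι → ℂ) :
    eval (fun i => t * x i) P = t ^ d * eval x P := by
  rw [eval_eq', eval_eq', Finset.mul_sum]
  refine Finset.sum_congr rfl fun e he => ?_
  have h : ∑ i, e i = d := by
    rw [← Finsupp.degree_eq_sum]
    exact (hP.degree_eq_sum_deg_support he).symm
  simp only [mul_pow, Finset.prod_mul_distrib, Finset.prod_pow_eq_pow_sum, h]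
  ring

lemma MvPolynomial.differentiable_eval {ι : Type*} [Fintype ι] (P : MvPolynomial ι ℂ) :
    Differentiable ℂ fun x : ι → ℂ => eval x P := fun x =>
  (AnalyticOnNhd.eval_mvPolynomial P x trivial).differentiableAt

/-- Adding a generic Fermat polynomial makes a homogeneous polynomial smooth. -/
lemma exists_forall_pderiv_add_sum_X_pow_ne_zero {ι : Type*} [Fintype ι] {A : MvPolynomial ι ℂ} {δ : ℕ}
    (hA : A.IsHomogeneous δ) (hδ : 1 ≤ δ) {ε : ℝ} (hε : 0 < ε) :
    ∃ c : ι → ℂ, (∀ i, ‖c i‖ < ε) ∧ ∀ x : ι → ℂ, x ≠ 0 →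
      ∃ i, eval x (pderiv i (A + ∑ i, C (c i) * X i ^ δ)) ≠ 0 := by
  classical
  have hpd : ∀ (c : ι → ℂ) (x : ι → ℂ) (i : ι), eval x (pderiv i (A + ∑ i, C (c i) * X i ^ δ)) =
      eval x (pderiv i A) + c i * (δ * x i ^ (δ - 1)) := by
    intro c x i
    rw [map_add, map_sum, Finset.sum_eq_single i, map_add]
    · rw [pderiv_C_mul, pderiv_pow, pderiv_X_self]
      simp
    · intro j _ hj
      rw [pderiv_C_mul, pderiv_pow, pderiv_X_of_ne hj]
      simp
    · simp
  set r : Finset ι → (ι → ℂ) → ι → ℂ := fun I y i => if i ∈ I then y i else 0 with hr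
  set Φ : Finset ι → (ι → ℂ) → ι → ℂ := fun I y i =>
    if i ∈ I then -eval (r I y) (pderiv i A) / (δ * y i ^ (δ - 1)) else y i with hΦ
  have hδ0 : (δ : ℂ) ≠ 0 := by exact_mod_cast (by omega : δ ≠ 0)
  have hnull : ∀ I : Finset ι, I.Nonempty →
      MeasureTheory.volume (Φ I '' {y | ∀ i ∈ I, y i ≠ 0}) = 0 := by
    intro I hI
    have hd : ∀ y ∈ {y : ι → ℂ | ∀ i ∈ I, y i ≠ 0}, DifferentiableAt ℂ (Φ I) y := by
      intro y hy
      rw [differentiableAt_pi]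
      intro i
      simp only [hΦ]
      split_ifs with hi
      · have h1 : DifferentiableAt ℂ (fun y => eval (r I y) (pderiv i A)) y := by
          refine ((pderiv i A).differentiable_eval _).comp (f := r I) y ?_
          rw [differentiableAt_pi]
          intro l
          simp only [hr]
          split_ifs <;> fun_prop
        have := mul_ne_zero hδ0 (pow_ne_zero (δ - 1) (hy i hi))
        fun_prop (disch := assumption)
      · fun_prop
    refine MeasureTheory.addHaar_image_eq_zero_of_det_fderivWithin_eq_zero _
      (f' := fun y => (fderiv ℂ (Φ I) y).restrictScalars ℝ)
      (fun y hy => ((hd y hy).hasFDerivAt.restrictScalars ℝ).hasFDerivWithinAt) fun y hy => ?_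
    have hker : fderiv ℂ (Φ I) y (r I y) = 0 := by
      have h1 : HasDerivAt (fun t : ℂ => y + (t - 1) • r I y) (r I y) 1 := by
        have := (((hasDerivAt_id (1 : ℂ)).sub_const 1).smul_const (r I y)).const_add y
        simpa using this
      have h2 : HasFDerivAt (Φ I) (fderiv ℂ (Φ I) y) (y + ((1 : ℂ) - 1) • r I y) := by
        simpa using (hd y hy).hasFDerivAt
      have h3 := h2.comp_hasDerivAt 1 h1
      have h4 : (Φ I ∘ fun t : ℂ => y + (t - 1) • r I y) =ᶠ[𝓝 1] fun _ => Φ I y := by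
        filter_upwards [isOpen_ne.mem_nhds (one_ne_zero : (1 : ℂ) ≠ 0)] with t ht
        have h5 : r I (y + (t - 1) • r I y) = fun i => t * r I y i := by
          funext i
          simp only [hr, Pi.add_apply, Pi.smul_apply, smul_eq_mul]
          split_ifs <;> ring
        funext i
        simp only [hΦ, Function.comp, h5]
        split_ifs with hi
        · rw [hA.pderiv.eval_mul_left]
          have h6 : (y + (t - 1) • r I y) i = t * y i := by
            simp only [hr, Pi.add_apply, Pi.smul_apply, smul_eq_mul, if_pos hi]
            ring
          rw [h6]
          have := hy i hi
          have ht : t ≠ 0 := ht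
          rw [mul_pow]
          field_simp
        · simp [hr, hi]
      exact h3.unique ((hasDerivAt_const _ _).congr_of_eventuallyEq h4)
    obtain ⟨i, hi⟩ := hI
    have hv : r I y ≠ 0 := fun h => hy i hi (by simpa [hr, hi] using congrFun h i)
    change LinearMap.det _ = 0
    refine LinearMap.det_eq_zero_iff_ker_ne_bot.2 fun h => hv ?_
    rw [← Submodule.mem_bot ℝ, ← h, LinearMap.mem_ker]
    exact hker
  have hnull2 : MeasureTheory.volume
      (⋃ I ∈ {I : Finset ι | I.Nonempty}, Φ I '' {y | ∀ i ∈ I, y i ≠ 0}) = 0 :=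
    (MeasureTheory.measure_biUnion_null_iff (Set.to_countable _)).2 hnull
  have hdense := MeasureTheory.Measure.dense_of_ae (MeasureTheory.measure_eq_zero_iff_ae_notMem.1 hnull2)
  obtain ⟨c, hc, hcε⟩ := hdense.exists_dist_lt 0 hε
  refine ⟨c, fun i => ?_, fun x hx => ?_⟩
  · rw [dist_zero_left] at hcε
    exact (norm_le_pi_norm c i).trans_lt hcε
  · by_contra! hall
    refine hc ?_
    simp only [mem_iUnion]
    refine ⟨Finset.univ.filter fun i => x i ≠ 0, ?_, ?_⟩
    · obtain ⟨i, hi⟩ := Function.ne_iff.1 hx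
      exact ⟨i, by simpa using hi⟩
    · refine ⟨fun i => if x i ≠ 0 then x i else c i, ?_, ?_⟩
      · intro i hi
        have : x i ≠ 0 := by simpa using hi
        simp [this]
      · have h1 : r (Finset.univ.filter fun i => x i ≠ 0)
            (fun i => if x i ≠ 0 then x i else c i) = x := by
          funext i
          by_cases h : x i = 0 <;> simp [hr, h]
        funext i
        simp only [hΦ, h1]
        by_cases h : x i = 0
        · simp [h]
        · have h2 := hall i
          rw [hpd] at h2
          simp only [Finset.mem_filter, Finset.mem_univ, true_and, ne_eq, h, not_false_eq_true,
            if_true]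
          field_simp
          linear_combination -h2

lemma smooth_cyclic_cover {n δ : ℕ} (hδ : 1 ≤ δ) {G : MvPolynomial (Fin (n + 1)) ℂ}
    (hG : ∀ x : Fin (n + 1) → ℂ, x ≠ 0 → ∃ i, eval x (pderiv i G) ≠ 0) (x : Fin (n + 2) → ℂ)
    (hx : x ≠ 0) : ∃ i, eval x (pderiv i (X (Fin.last (n + 1)) ^ δ - rename Fin.castSucc G :
      MvPolynomial (Fin (n + 2)) ℂ)) ≠ 0 := by
  by_cases hl : x (Fin.last (n + 1)) = 0
  · have hx' : (fun i => x (Fin.castSucc i)) ≠ 0 := by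
      intro h
      refine hx (funext fun i => ?_)
      refine Fin.lastCases hl (fun j => congrFun h j) i
    obtain ⟨i, hi⟩ := hG _ hx'
    refine ⟨Fin.castSucc i, ?_⟩
    rw [map_sub, pderiv_pow, pderiv_X_of_ne (Fin.castSucc_lt_last i).ne', mul_zero, zero_sub,
      map_neg, pderiv_rename (Fin.castSucc_injective _), eval_rename, neg_ne_zero]
    exact hi
  · refine ⟨Fin.last (n + 1), ?_⟩
    have h0 : pderiv (Fin.last (n + 1)) (rename Fin.castSucc G) = 0 := by
      refine pderiv_eq_zero_of_notMem_vars fun h => ?_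
      have := vars_rename Fin.castSucc G h
      obtain ⟨j, -, hj⟩ := Finset.mem_image.1 this
      exact (Fin.castSucc_lt_last j).ne hj
    rw [map_sub, h0, sub_zero, pderiv_pow, pderiv_X_self]
    simp only [mul_one, map_mul, map_natCast, map_pow, eval_X]
    exact mul_ne_zero (by exact_mod_cast (by omega : δ ≠ 0)) (pow_ne_zero _ hl)

section projDensity

variable {ι : Type*} [Fintype ι] {g : ι → ℂ → ℂ}

lemma projDensity_le_sum_norm_div (hg : ∀ i, Differentiable ℂ (g i)) {i : ι} {y : ℂ}
    (hi : g i y ≠ 0) : projDensity g y ≤ ∑ a, ∑ b,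
      ‖g a y / g i y * deriv (fun y => g b y / g i y) y -
        g b y / g i y * deriv (fun y => g a y / g i y) y‖ := by
  have hi' : 0 < ‖g i y‖ := norm_pos_iff.2 hi
  have hle : ‖g i y‖ ^ 2 ≤ ∑ i, ‖g i y‖ ^ 2 :=
    Finset.single_le_sum (f := fun i => ‖g i y‖ ^ 2) (fun _ _ => by positivity) (Finset.mem_univ i)
  calc projDensity g y
      ≤ (∑ a, ∑ b, ‖g a y * deriv (g b) y - g b y * deriv (g a) y‖) / ‖g i y‖ ^ 2 := by
        unfold projDensity; gcongr
    _ = _ := by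
        rw [Finset.sum_div]
        refine Finset.sum_congr rfl fun a _ => ?_
        rw [Finset.sum_div]
        refine Finset.sum_congr rfl fun b _ => ?_
        rw [deriv_fun_div (hg b y) (hg i y) hi, deriv_fun_div (hg a y) (hg i y) hi, ← norm_pow,
          ← norm_div]
        congr 1
        field_simp
        ring

/-- Extraction of a holomorphic limit, in local charts, from a sequence of Brody curves. -/
lemma exists_limit_charts [Nonempty ι] (𝒰 : Ultrafilter ℕ) (h𝒰 : (𝒰 : Filter ℕ) ≤ atTop)
    {g : ℕ → ι → ℂ → ℂ} (hg : ∀ j i, Differentiable ℂ (g j i))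
    (hg0 : ∀ j y, ∃ i, g j i y ≠ 0)
    (hD : ∀ (j : ℕ), ∀ y ∈ closedBall (0 : ℂ) j, projDensity (g j) y ≤ 2)
    (hD1 : ∀ j, projDensity (g j) 0 = 1) :
    ∃ ρ > 0, ∃ (s : ℂ → ι) (H : ℂ → ι → ℂ → ℂ),
      (∀ p, ∀ᶠ j in (𝒰 : Filter ℕ), ∀ y ∈ ball p ρ, g j (s p) y ≠ 0 ∧
        ∀ l, ‖g j l y / g j (s p) y‖ ≤ 2) ∧
      (∀ p l, DifferentiableOn ℂ (H p l) (ball p ρ)) ∧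
      (∀ p l, ∀ y ∈ ball p ρ, Tendsto (fun j => g j l y / g j (s p) y) 𝒰 (𝓝 (H p l y))) ∧
      ∃ l, deriv (H 0 l) 0 ≠ 0 := by
  have hcard : 0 < (Fintype.card ι : ℝ) := by exact_mod_cast Fintype.card_pos
  set ρ : ℝ := 1 / (16 * Fintype.card ι) with hρ
  have hρ0 : 0 < ρ := by positivity
  have hs : ∀ p, ∃ i, ∀ᶠ j in (𝒰 : Filter ℕ), ∀ l, ‖g j l p‖ ≤ ‖g j i p‖ := by
    intro p
    have h1 : ∀ j, ∃ i, ∀ l, ‖g j l p‖ ≤ ‖g j i p‖ := fun j => by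
      obtain ⟨i, -, hi⟩ := Finset.exists_max_image Finset.univ (fun i => ‖g j i p‖)
        Finset.univ_nonempty
      exact ⟨i, fun l => hi l (Finset.mem_univ l)⟩
    have h2 : ∀ᶠ j in (𝒰 : Filter ℕ), ∃ i ∈ (Set.univ : Set ι), ∀ l, ‖g j l p‖ ≤ ‖g j i p‖ :=
      Eventually.of_forall fun j => by simpa using h1 j
    obtain ⟨i, -, hi⟩ := (Ultrafilter.eventually_exists_mem_iff Set.finite_univ).1 h2
    exact ⟨i, hi⟩
  choose s hs using hs
  have hb : ∀ p, ∀ᶠ j in (𝒰 : Filter ℕ), ∀ y ∈ ball p ρ, g j (s p) y ≠ 0 ∧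
        ∀ l, ‖g j l y / g j (s p) y‖ ≤ 2 := by
    intro p
    filter_upwards [hs p, h𝒰 (tendsto_natCast_atTop_atTop.eventually_ge_atTop (‖p‖ + ρ))]
      with j hj1 hj2 y hy
    have h1 := norm_le_two_mul_of_projDensity_le (hg j) (hg0 j) (p := p) (ρ := ρ)
      (by rw [hρ]; field_simp; rfl) (fun y hy => hD j y ?_) hj1 y hy
    · have h2 : g j (s p) y ≠ 0 := by
        intro h
        obtain ⟨l, hl⟩ := hg0 j y
        have := h1 l
        rw [h, norm_zero, mul_zero] at this
        exact hl (norm_le_zero_iff.1 this)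
      refine ⟨h2, fun l => ?_⟩
      rw [norm_div, div_le_iff₀ (norm_pos_iff.2 h2)]
      exact h1 l
    · rw [mem_closedBall_zero_iff]
      rw [mem_ball, dist_eq_norm] at hy
      have := norm_le_norm_add_norm_sub p y
      rw [norm_sub_rev] at this
      linarith
  have hlim : ∀ p l, ∃ H : ℂ → ℂ, DifferentiableOn ℂ H (ball p ρ) ∧
      (∀ y ∈ ball p ρ, Tendsto (fun j => g j l y / g j (s p) y) 𝒰 (𝓝 (H y))) ∧
      ∀ y ∈ ball p ρ, Tendsto (fun j => deriv (fun y => g j l y / g j (s p) y) y) 𝒰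
        (𝓝 (deriv H y)) := by
    intro p l
    refine exists_differentiableOn_tendsto_of_bounded (C := 2) ?_
    filter_upwards [hb p] with j hj
    exact ⟨fun y hy => ((hg j l y).div (hg j (s p) y) (hj y hy).1).differentiableWithinAt,
      fun y hy => (hj y hy).2 l⟩
  choose H hHd hHt hHt' using hlim
  refine ⟨ρ, hρ0, s, H, hb, hHd, hHt, ?_⟩
  by_contra! hall
  have h0 := mem_ball_self (x := (0 : ℂ)) hρ0
  have ht : Tendsto (fun j => ∑ a, ∑ b,
      ‖g j a 0 / g j (s 0) 0 * deriv (fun y => g j b y / g j (s 0) y) 0 -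
        g j b 0 / g j (s 0) 0 * deriv (fun y => g j a y / g j (s 0) y) 0‖) 𝒰
      (𝓝 (∑ a, ∑ b, ‖H 0 a 0 * deriv (H 0 b) 0 - H 0 b 0 * deriv (H 0 a) 0‖)) :=
    tendsto_finsetSum _ fun a _ => tendsto_finsetSum _ fun b _ =>
      (((hHt 0 a 0 h0).mul (hHt' 0 b 0 h0)).sub ((hHt 0 b 0 h0).mul (hHt' 0 a 0 h0))).norm
  have hge := ge_of_tendsto ht (b := 1) <| by
    filter_upwards [hb 0] with j hj
    rw [← hD1 j]
    exact projDensity_le_sum_norm_div (hg j) (hj 0 h0).1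
  simp [hall] at hge
  linarith

end projDensity

/-- The polynomial `(a F) ^ m + ∑ P_i (a F) ^ i + ∑ c_i X_i ^ δ`. -/
noncomputable def coverPoly {n : ℕ} (F : MvPolynomial (Fin (n + 1)) ℂ)
    (P : Fin n → MvPolynomial (Fin (n + 1)) ℂ) (m δ : ℕ) (a : ℂ) (c : Fin (n + 1) → ℂ) :
    MvPolynomial (Fin (n + 1)) ℂ :=
  (C a * F) ^ m + ∑ i, P i * (C a * F) ^ (i : ℕ) + ∑ i, C (c i) * X i ^ δ

/-- Limit of a sequence of Brody curves on the hypersurfaces `w ^ (k * m) = coverPoly F P m (k * m) j`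
for `j → ∞`: a holomorphic map to projective space in local charts `H p` on the balls of radius `ρ`,
together with the limits `U p` of `j * F`. -/
structure CoverLimit {n : ℕ} (F : MvPolynomial (Fin (n + 1)) ℂ)
    (P : Fin n → MvPolynomial (Fin (n + 1)) ℂ) (k m : ℕ) where
  ρ : ℝ
  s : ℂ → Fin (n + 2)
  H : ℂ → Fin (n + 2) → ℂ → ℂ
  U : ℂ → ℂ → ℂ
  M : ℝ
  ρ_pos : 0 < ρ
  diffH : ∀ p l, DifferentiableOn ℂ (H p l) (ball p ρ)
  diffU : ∀ p, DifferentiableOn ℂ (U p) (ball p ρ)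
  H_self : ∀ p, ∀ y ∈ ball p ρ, H p (s p) y = 1
  norm_H_le : ∀ p l, ∀ y ∈ ball p ρ, ‖H p l y‖ ≤ 2
  norm_U_le : ∀ p, ∀ y ∈ ball p ρ, ‖U p y‖ ≤ M
  eval_F : ∀ p, ∀ y ∈ ball p ρ, eval (fun i => H p (Fin.castSucc i) y) F = 0
  eq : ∀ p, ∀ y ∈ ball p ρ, H p (Fin.last (n + 1)) y ^ (k * m) = U p y ^ m +
    ∑ i, eval (fun i => H p (Fin.castSucc i) y) (P i) * U p y ^ (i : ℕ)
  compat : ∀ p q, ∀ y ∈ ball p ρ, y ∈ ball q ρ → ∀ i l, H p i y * H q l y = H p l y * H q i y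
  compatU : ∀ p q, ∀ y ∈ ball p ρ, y ∈ ball q ρ → ∀ i, U p y * H q i y ^ k = U q y * H p i y ^ k
  deriv_ne : ∃ l, deriv (H 0 l) 0 ≠ 0

lemma nonempty_coverLimit {n k m : ℕ} {F : MvPolynomial (Fin (n + 1)) ℂ}
    {P : Fin n → MvPolynomial (Fin (n + 1)) ℂ} (hF : F.IsHomogeneous k)
    (hnm : n < m)
    {c : ℕ → Fin (n + 1) → ℂ} (hc : ∀ j i, ‖c j i‖ ≤ 1 / (j + 1))
    (hhom : ∀ j : ℕ, (coverPoly F P m (k * m) j (c j)).IsHomogeneous (k * m))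
    {g : ℕ → Fin (n + 2) → ℂ → ℂ} (hg : ∀ j i, Differentiable ℂ (g j i))
    (hg0 : ∀ j y, ∃ i, g j i y ≠ 0)
    (hD : ∀ (j : ℕ), ∀ y ∈ closedBall (0 : ℂ) j, projDensity (g j) y ≤ 2)
    (hD1 : ∀ j, projDensity (g j) 0 = 1)
    (heq : ∀ j y, g j (Fin.last (n + 1)) y ^ (k * m) =
      eval (fun i => g j (Fin.castSucc i) y) (coverPoly F P m (k * m) j (c j))) :
    Nonempty (CoverLimit F P k m) := by
  set 𝒰 : Ultrafilter ℕ := hyperfilter ℕ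
  have h𝒰 : (𝒰 : Filter ℕ) ≤ atTop := Nat.hyperfilter_le_atTop
  obtain ⟨ρ, hρ, s, H, hb, hHd, hHt, hd⟩ := exists_limit_charts 𝒰 h𝒰 hg hg0 hD hD1
  set h : ℂ → ℕ → Fin (n + 2) → ℂ → ℂ := fun p j l y => g j l y / g j (s p) y with hh
  set z : ℂ → ℕ → ℂ → Fin (n + 1) → ℂ := fun p j y i => h p j (Fin.castSucc i) y with hz
  set v : ℂ → ℕ → ℂ → ℂ := fun p j y => j * eval (z p j y) F with hv
  have hveq : ∀ p j y, h p j (Fin.last (n + 1)) y ^ (k * m) = v p j y ^ m +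
      ∑ i, eval (z p j y) (P i) * v p j y ^ (i : ℕ) +
        ∑ i, c j i * z p j y i ^ (k * m) := by
    intro p j y
    have h1 := (hhom j).eval_mul_left (g j (s p) y)⁻¹ fun i => g j (Fin.castSucc i) y
    rw [← heq, ← mul_pow] at h1
    have h2 : (fun i => (g j (s p) y)⁻¹ * g j (Fin.castSucc i) y) = z p j y := by
      funext i; simp only [hz, hh]; ring
    rw [h2] at h1
    simp only [hh]
    rw [div_eq_inv_mul, ← h1, coverPoly]
    simp [hv]
  have hK : IsCompact (closedBall (0 : Fin (n + 1) → ℂ) 2) := isCompact_closedBall _ _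
  have hPb : ∃ B : ℝ, ∀ i, ∀ x ∈ closedBall (0 : Fin (n + 1) → ℂ) 2, ‖eval x (P i)‖ ≤ B := by
    choose B hB using fun i => hK.exists_bound_of_continuousOn
      (P i).differentiable_eval.continuous.continuousOn
    refine ⟨∑ i, |B i|, fun i x hx => (hB i x hx).trans ((le_abs_self _).trans ?_)⟩
    exact Finset.single_le_sum (f := fun i => |B i|) (fun _ _ => abs_nonneg _) (Finset.mem_univ i)
  obtain ⟨B, hB⟩ := hPb
  set B' : ℝ := max B (2 ^ (k * m) + ∑ i : Fin (n + 1), 2 ^ (k * m)) with hB'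
  have hvb : ∀ p, ∀ᶠ j in (𝒰 : Filter ℕ), ∀ y ∈ ball p ρ, ‖v p j y‖ ≤ max 1 ((n + 1) * B') := by
    intro p
    filter_upwards [hb p] with j hj y hy
    have hj2 := (hj y hy).2
    refine norm_le_of_pow_add_sum_eq hnm (b := fun i => eval (z p j y) (P i))
      (γ := h p j (Fin.last (n + 1)) y ^ (k * m) - ∑ i, c j i * z p j y i ^ (k * m)) ?_ ?_ ?_
    · intro i
      refine (hB i _ ?_).trans (le_max_left _ _)
      rw [mem_closedBall_zero_iff, pi_norm_le_iff_of_nonneg (by norm_num)]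
      exact fun i => hj2 _
    · refine le_trans ((norm_sub_le _ _).trans (add_le_add ?_ (norm_sum_le_of_le _ fun i _ => ?_)))
        (le_max_right _ _)
      · rw [norm_pow]
        exact pow_le_pow_left₀ (norm_nonneg _) (hj2 _) _
      · rw [norm_mul, norm_pow]
        have h1 : ‖c j i‖ ≤ 1 := (hc j i).trans (by
          rw [div_le_one (by positivity)]; linarith [(Nat.cast_nonneg j : (0 : ℝ) ≤ j)])
        rw [← one_mul ((2 : ℝ) ^ (k * m))]
        exact mul_le_mul h1 (pow_le_pow_left₀ (norm_nonneg _) (hj2 _) _) (by positivity)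
          zero_le_one
    · rw [hveq]; ring
  have hzt : ∀ p, ∀ y ∈ ball p ρ,
      Tendsto (fun j => z p j y) 𝒰 (𝓝 fun i => H p (Fin.castSucc i) y) := fun p y hy =>
    tendsto_pi_nhds.2 fun i => hHt p _ y hy
  have hev : ∀ (Q : MvPolynomial (Fin (n + 1)) ℂ) p, ∀ y ∈ ball p ρ, Tendsto
      (fun j => eval (z p j y) Q) 𝒰 (𝓝 (eval (fun i => H p (Fin.castSucc i) y) Q)) :=
    fun Q p y hy => (Q.differentiable_eval.continuous.tendsto _).comp (hzt p y hy)
  have hlim : ∀ p, ∃ U : ℂ → ℂ, DifferentiableOn ℂ U (ball p ρ) ∧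
      ∀ y ∈ ball p ρ, Tendsto (fun j => v p j y) 𝒰 (𝓝 (U y)) := by
    intro p
    obtain ⟨U, hU1, hU2, -⟩ := exists_differentiableOn_tendsto_of_bounded (𝒰 := 𝒰) (h := v p)
      (p := p) (ρ := ρ) (C := max 1 ((n + 1) * B')) (by
        filter_upwards [hb p, hvb p] with j hj hj'
        refine ⟨fun y hy => DifferentiableAt.differentiableWithinAt ?_, hj'⟩
        have : DifferentiableAt ℂ (z p j) y := differentiableAt_pi.2 fun i =>
          (hg j _ y).div (hg j (s p) y) (hj y hy).1
        exact (((F.differentiable_eval _).comp y this).const_mul _))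
    exact ⟨U, hU1, hU2⟩
  choose U hUd hUt using hlim
  have hinv : Tendsto (fun j : ℕ => 1 / ((j : ℝ) + 1)) 𝒰 (𝓝 0) :=
    tendsto_one_div_add_atTop_nhds_zero_nat.mono_left h𝒰
  have hc0 : ∀ i, Tendsto (fun j => c j i) 𝒰 (𝓝 0) := fun i =>
    squeeze_zero_norm (fun j => hc j i) hinv
  refine ⟨{ ρ := ρ, s := s, H := H, U := U, M := max 1 ((n + 1) * B'), ρ_pos := hρ, diffH := hHd,
            diffU := hUd, deriv_ne := hd, H_self := ?_, norm_H_le := ?_,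
            norm_U_le := ?_, eval_F := ?_, eq := ?_, compat := ?_, compatU := ?_ }⟩
  · intro p y hy
    refine tendsto_nhds_unique (hHt p (s p) y hy) (tendsto_const_nhds.congr' ?_)
    filter_upwards [hb p] with j hj
    rw [div_self (hj y hy).1]
  · intro p l y hy
    refine le_of_tendsto (hHt p l y hy).norm ?_
    filter_upwards [hb p] with j hj using (hj y hy).2 l
  · intro p y hy
    refine le_of_tendsto (hUt p y hy).norm ?_
    filter_upwards [hvb p] with j hj using hj y hy
  · intro p y hy
    have hinv' : Tendsto (fun j : ℕ => 1 / ((j : ℂ))) 𝒰 (𝓝 0) :=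
      tendsto_one_div_atTop_nhds_zero_nat.mono_left h𝒰
    have h1 := hinv'.mul (hUt p y hy)
    rw [zero_mul] at h1
    refine tendsto_nhds_unique (hev F p y hy) (h1.congr' ?_)
    filter_upwards [h𝒰 (eventually_ge_atTop 1)] with j hj
    have : (j : ℂ) ≠ 0 := by exact_mod_cast (by omega : j ≠ 0)
    simp only [hv]
    field_simp
  · intro p y hy
    have h1 := (hHt p (Fin.last (n + 1)) y hy).pow (k * m)
    have h2 : Tendsto (fun j => v p j y ^ m + ∑ i, eval (z p j y) (P i) * v p j y ^ (i : ℕ) +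
        ∑ i, c j i * z p j y i ^ (k * m)) 𝒰 (𝓝 (U p y ^ m +
        ∑ i, eval (fun i => H p (Fin.castSucc i) y) (P i) * U p y ^ (i : ℕ) +
        ∑ i : Fin (n + 1), 0 * H p (Fin.castSucc i) y ^ (k * m))) :=
      (((hUt p y hy).pow m).add (tendsto_finsetSum _ fun i _ =>
        (hev (P i) p y hy).mul ((hUt p y hy).pow _))).add
        (tendsto_finsetSum _ fun i _ => (hc0 i).mul ((hHt p _ y hy).pow _))
    have h3 := tendsto_nhds_unique h1 (h2.congr fun j => (hveq p j y).symm)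
    rw [h3]
    simp
  · intro p q y hp hq i l
    refine tendsto_nhds_unique ((hHt p i y hp).mul (hHt q l y hq)) ?_
    refine ((hHt p l y hp).mul (hHt q i y hq)).congr fun j => ?_
    ring
  · intro p q y hp hq i
    refine tendsto_nhds_unique ((hUt p y hp).mul ((hHt q i y hq).pow k)) ?_
    refine ((hUt q y hq).mul ((hHt p i y hp).pow k)).congr fun j => ?_
    have h1 : ∀ p, v p j y = j * ((g j (s p) y)⁻¹ ^ k *
        eval (fun i => g j (Fin.castSucc i) y) F) := by
      intro p
      simp only [hv]
      rw [← hF.eval_mul_left]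
      congr 2
      congr 1
      funext i
      simp only [hz, hh]
      ring
    rw [h1, h1]
    ring

/-- Finitely many analytic functions which do not all vanish identically have a common zero of finite
order, which can be divided out. -/
lemma exists_common_order {ι : Type*} [Fintype ι] [Nonempty ι] {f : ι → ℂ → ℂ} {p : ℂ}
    (hf : ∀ i, AnalyticAt ℂ (f i) p) (hne : ¬ ∀ᶠ y in 𝓝 p, ∀ i, f i y = 0) :
    ∃ (e : ℕ) (K : ι → ℂ → ℂ), (∀ i, AnalyticAt ℂ (K i) p) ∧ (∃ i, K i p ≠ 0) ∧
      ∀ᶠ y in 𝓝 p, ∀ i, f i y = (y - p) ^ e * K i y := by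
  obtain ⟨i₀, -, hi₀⟩ := Finset.exists_min_image Finset.univ (fun i => analyticOrderAt (f i) p)
    Finset.univ_nonempty
  have htop : analyticOrderAt (f i₀) p ≠ ⊤ := by
    intro h
    refine hne (eventually_all.2 fun i => analyticOrderAt_eq_top.1 ?_)
    exact top_le_iff.1 (h ▸ hi₀ i (Finset.mem_univ i))
  obtain ⟨e, he⟩ := ENat.ne_top_iff_exists.1 htop
  have hK : ∀ i, ∃ K : ℂ → ℂ, AnalyticAt ℂ K p ∧ ∀ᶠ y in 𝓝 p, f i y = (y - p) ^ e • K y :=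
    fun i => (natCast_le_analyticOrderAt (hf i)).1 (he ▸ hi₀ i (Finset.mem_univ i))
  choose K hKa hKe using hK
  refine ⟨e, K, hKa, ⟨i₀, fun h0 => ?_⟩, eventually_all.2 hKe⟩
  obtain ⟨g, hga, hg0, hge⟩ := (hf i₀).analyticOrderAt_eq_natCast.1 he.symm
  have h1 : ∀ᶠ y in 𝓝[≠] p, K i₀ y = g y := by
    filter_upwards [nhdsWithin_le_nhds (hKe i₀), nhdsWithin_le_nhds hge, self_mem_nhdsWithin]
      with y h1 h2 h3
    rw [h1] at h2
    exact mul_left_cancel₀ (pow_ne_zero e (sub_ne_zero.2 h3)) h2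
  have h2 : Tendsto (K i₀) (𝓝[≠] p) (𝓝 (K i₀ p)) :=
    (hKa i₀).continuousAt.tendsto.mono_left nhdsWithin_le_nhds
  have h3 : Tendsto g (𝓝[≠] p) (𝓝 (g p)) :=
    hga.continuousAt.tendsto.mono_left nhdsWithin_le_nhds
  exact hg0 ((tendsto_nhds_unique (h2.congr' h1) h3).symm.trans h0)

namespace CoverLimit

variable {n k m : ℕ} {F : MvPolynomial (Fin (n + 1)) ℂ}
  {P : Fin n → MvPolynomial (Fin (n + 1)) ℂ}

lemma analyticOnNhd_H (L : CoverLimit F P k m) (p : ℂ) (l : Fin (n + 2)) :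
    AnalyticOnNhd ℂ (L.H p l) (ball p L.ρ) :=
  (L.diffH p l).analyticOnNhd isOpen_ball

lemma not_eventually_eq_zero (L : CoverLimit F P k m) (p : ℂ) :
    ¬ ∀ᶠ y in 𝓝 p, ∀ i : Fin (n + 1), L.H p (Fin.castSucc i) y = 0 := by
  set E : Set ℂ := {p | ∀ᶠ y in 𝓝 p, ∀ i : Fin (n + 1), L.H p (Fin.castSucc i) y = 0} with hE
  have hstep : ∀ x ∈ E, ∀ p, dist x p < L.ρ → p ∈ E := by
    intro x hx p hxp
    refine eventually_all.2 fun i => ?_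
    have h1 : L.H p (Fin.castSucc i) =ᶠ[𝓝 x] 0 := by
      filter_upwards [hx, ball_mem_nhds x L.ρ_pos, isOpen_ball.mem_nhds (mem_ball.2 hxp)]
        with y h1 h2 h3
      have h4 := L.compat p x y h3 h2 (Fin.castSucc i) (L.s x)
      rw [L.H_self x y h2, h1 i, mul_one, mul_zero] at h4
      exact h4
    have h2 := (L.analyticOnNhd_H p (Fin.castSucc i)).eqOn_zero_of_preconnected_of_eventuallyEq_zero
      (convex_ball p L.ρ).isPreconnected (mem_ball.2 hxp) h1
    filter_upwards [ball_mem_nhds p L.ρ_pos] with y hy using h2 hy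
  have hclopen : IsClopen E := by
    constructor
    · refine isClosed_of_closure_subset fun p hp => ?_
      obtain ⟨x, hx, hxp⟩ := Metric.mem_closure_iff.1 hp L.ρ L.ρ_pos
      exact hstep x hx p (by rwa [dist_comm])
    · refine Metric.isOpen_iff.2 fun x hx => ⟨L.ρ, L.ρ_pos, fun p hp => ?_⟩
      exact hstep x hx p (by rwa [dist_comm])
  rcases isClopen_iff.1 hclopen with h | h
  · intro hp
    have : p ∈ E := hp
    rw [h] at this
    exact this
  · exfalso
    have h0 : (0 : ℂ) ∈ E := by rw [h]; trivial
    have hlast : L.s 0 = Fin.last (n + 1) := by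
      have hs := L.H_self 0 0 (mem_ball_self L.ρ_pos)
      by_contra hne
      obtain ⟨i, hi⟩ := Fin.exists_castSucc_eq.2 hne
      rw [← hi, h0.self_of_nhds i] at hs
      exact zero_ne_one hs
    obtain ⟨l, hl⟩ := L.deriv_ne
    refine hl ?_
    refine Fin.lastCases ?_ (fun i => ?_) l
    · have : L.H 0 (Fin.last (n + 1)) =ᶠ[𝓝 0] fun _ => 1 := by
        filter_upwards [ball_mem_nhds 0 L.ρ_pos] with y hy
        rw [← hlast, L.H_self 0 y hy]
      rw [this.deriv_eq, deriv_const]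
    · have : L.H 0 (Fin.castSucc i) =ᶠ[𝓝 0] fun _ => 0 := h0.mono fun y hy => hy i
      rw [this.deriv_eq, deriv_const]

/-- As `F = 0` is hyperbolic, the projection of the limit curve to this hypersurface is constant. -/
lemma exists_proj_const (L : CoverLimit F P k m) (hF : F.IsHomogeneous k)
    (hB : IsBrodyHyperbolicHypersurface F) :
    ∃ (a : Fin (n + 1) → ℂ) (l₀ : Fin (n + 1)), a l₀ = 1 ∧ eval a F = 0 ∧
      ∀ p, ∀ y ∈ ball p L.ρ, ∀ l,
        L.H p (Fin.castSucc l) y = a l * L.H p (Fin.castSucc l₀) y := by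
  have hHa : ∀ p (i : Fin (n + 1)), AnalyticAt ℂ (L.H p (Fin.castSucc i)) p := fun p i =>
    L.analyticOnNhd_H p _ p (mem_ball_self L.ρ_pos)
  choose e K hKa hK0 hKe using fun p => exists_common_order (hHa p) (L.not_eventually_eq_zero p)
  obtain ⟨Z, hZd, hZ0, hZK⟩ := exists_entire_lift hKa hK0 (fun p => by
    have hKp : ∀ᶠ x in 𝓝 p, ∀ i, AnalyticAt ℂ (K p i) x :=
      eventually_all.2 fun i => (hKa p i).eventually_analyticAt
    filter_upwards [hKp, (hKe p).eventually_nhds, ball_mem_nhds p L.ρ_pos] with x h1 h2 h3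
    refine eventually_all.2 fun i => eventually_all.2 fun l => ?_
    have h4 : AnalyticAt ℂ (fun y => K p i y * K x l y) x := (h1 i).mul (hKa x l)
    have h5 : AnalyticAt ℂ (fun y => K p l y * K x i y) x := (h1 l).mul (hKa x i)
    refine (h4.frequently_eq_iff_eventually_eq h5).1 (Eventually.frequently ?_)
    have hyp : ∀ᶠ y in 𝓝[≠] x, y ≠ p := by
      by_cases hxp : x = p
      · subst hxp; exact self_mem_nhdsWithin
      · exact nhdsWithin_le_nhds (isOpen_ne.mem_nhds hxp)
    filter_upwards [nhdsWithin_le_nhds h2, nhdsWithin_le_nhds (hKe x), hyp, self_mem_nhdsWithin,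
      nhdsWithin_le_nhds (ball_mem_nhds x L.ρ_pos),
      nhdsWithin_le_nhds (isOpen_ball.mem_nhds h3)] with y h6 h7 h8 h9 h10 h11
    have h12 := L.compat p x y h11 h10 (Fin.castSucc i) (Fin.castSucc l)
    rw [h6, h6, h7, h7] at h12
    have h13 : (y - p) ^ e p * (y - x) ^ e x ≠ 0 :=
      mul_ne_zero (pow_ne_zero _ (sub_ne_zero.2 h8)) (pow_ne_zero _ (sub_ne_zero.2 h9))
    apply mul_left_cancel₀ h13
    linear_combination h12)
  have hZH : ∀ p, ∀ᶠ y in 𝓝[≠] p, ∃ t : ℂ, t ≠ 0 ∧ ∀ i, Z i y = t * L.H p (Fin.castSucc i) y := by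
    intro p
    obtain ⟨κ, -, hκ⟩ := hZK p
    filter_upwards [nhdsWithin_le_nhds hκ, nhdsWithin_le_nhds (hKe p), self_mem_nhdsWithin]
      with y h1 h2 h3
    have h4 : (y - p) ^ e p ≠ 0 := pow_ne_zero _ (sub_ne_zero.2 h3)
    refine ⟨κ y / (y - p) ^ e p, div_ne_zero ?_ h4, fun i => ?_⟩
    · intro h
      obtain ⟨i, hi⟩ := hZ0 y
      rw [h1, h, zero_mul] at hi
      exact hi rfl
    · rw [h1, h2]
      field_simp
  have hZF : ∀ p, eval (fun i => Z i p) F = 0 := by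
    intro p
    have hcont : Continuous fun y => eval (fun i => Z i y) F :=
      F.differentiable_eval.continuous.comp (continuous_pi fun i => (hZd i).continuous)
    have h1 : Tendsto (fun y => eval (fun i => Z i y) F) (𝓝[≠] p) (𝓝 (eval (fun i => Z i p) F)) :=
      (hcont.tendsto p).mono_left nhdsWithin_le_nhds
    refine tendsto_nhds_unique h1 (tendsto_const_nhds.congr' ?_)
    filter_upwards [hZH p, nhdsWithin_le_nhds (ball_mem_nhds p L.ρ_pos)] with y hex hy
    obtain ⟨t, -, ht⟩ := hex
    simp only [ht]
    rw [hF.eval_mul_left, L.eval_F p y hy, mul_zero]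
  obtain ⟨c, u, -, hcu⟩ := hB Z hZd hZ0 hZF
  obtain ⟨l₀, hl₀⟩ := hZ0 0
  have hc0 : c l₀ ≠ 0 := fun h => hl₀ (by rw [hcu, h, zero_mul])
  have hu0 : u 0 ≠ 0 := fun h => hl₀ (by rw [hcu, h, mul_zero])
  refine ⟨fun i => c i / c l₀, l₀, div_self hc0, ?_, fun p y hy l => ?_⟩
  · have h1 := hZF 0
    have h2 : (fun i => Z i 0) = fun i => (c l₀ * u 0) * (c i / c l₀) := by
      funext i
      rw [hcu]
      field_simp
    rw [h2, hF.eval_mul_left] at h1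
    exact (mul_eq_zero.1 h1).resolve_left (pow_ne_zero _ (mul_ne_zero hc0 hu0))
  · have h1 : AnalyticOnNhd ℂ (fun y => c l / c l₀ * L.H p (Fin.castSucc l₀) y) (ball p L.ρ) :=
      fun y hy => analyticAt_const.mul (L.analyticOnNhd_H p _ y hy)
    refine (L.analyticOnNhd_H p (Fin.castSucc l)).eqOn_of_preconnected_of_frequently_eq h1
      (convex_ball p L.ρ).isPreconnected (mem_ball_self L.ρ_pos) (Eventually.frequently ?_) hy
    filter_upwards [hZH p] with y hex
    obtain ⟨t, ht0, ht⟩ := hex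
    have h3 := ht l
    have h4 := ht l₀
    rw [hcu] at h3 h4
    field_simp
    apply mul_left_cancel₀ ht0
    linear_combination c l * h4 - c l₀ * h3

end CoverLimit

/-- Cauchy's estimate for the derivative at the centre of a ball. -/
lemma norm_deriv_center_le {f : ℂ → ℂ} {p : ℂ} {ρ M : ℝ} (hρ : 0 < ρ)
    (hf : DifferentiableOn ℂ f (ball p ρ)) (hM : ∀ y ∈ ball p ρ, ‖f y‖ ≤ M) :
    ‖deriv f p‖ ≤ 2 * M / ρ := by
  have hsub : closedBall p (ρ / 2) ⊆ ball p ρ := closedBall_subset_ball (by linarith)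
  have h := Complex.norm_deriv_le_of_forall_mem_sphere_norm_le (c := p) (R := ρ / 2) (C := M) (f := f)
    (by linarith) (hf.diffContOnCl_ball hsub) fun z hz => hM z (hsub (sphere_subset_closedBall hz))
  calc ‖deriv f p‖ ≤ M / (ρ / 2) := h
    _ = 2 * M / ρ := by field_simp

/-- Estimates for the affine coordinates `ω = W / S`, `φ = U / S ^ k` of a bounded projective chart in
which one of the homogeneous coordinates `α * S`, `W` is normalized to `1`. -/
lemma affine_chart_bounds {S W U ω φ : ℂ → ℂ} {p : ℂ} {ρ M b : ℝ} {k : ℕ} (hk : 1 ≤ k) (hρ : 0 < ρ)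
    (hb : 1 ≤ b) (hSd : DifferentiableOn ℂ S (ball p ρ)) (hWd : DifferentiableOn ℂ W (ball p ρ))
    (hUd : DifferentiableOn ℂ U (ball p ρ)) (hS : ∀ y ∈ ball p ρ, ‖S y‖ ≤ 2)
    (hW : ∀ y ∈ ball p ρ, ‖W y‖ ≤ 2) (hU : ∀ y ∈ ball p ρ, ‖U y‖ ≤ M) (hS0 : S p ≠ 0)
    (hω : ω =ᶠ[𝓝 p] fun y => W y / S y) (hφ : φ =ᶠ[𝓝 p] fun y => U y / S y ^ k)
    (hcase : (∃ α : ℂ, ‖α‖ ≤ b ∧ ∀ y ∈ ball p ρ, α * S y = 1) ∨ ∀ y ∈ ball p ρ, W y = 1) :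
    ‖φ p‖ ≤ b ^ k * (M + 2 * M / ρ + k * (4 * M / ρ) + 4 / ρ) * max 1 ‖ω p‖ ^ k ∧
    ‖deriv φ p‖ ≤ b ^ k * (M + 2 * M / ρ + k * (4 * M / ρ) + 4 / ρ) * max 1 ‖ω p‖ ^ (k + 1) ∧
    ‖deriv ω p‖ ≤ b ^ k * (M + 2 * M / ρ + k * (4 * M / ρ) + 4 / ρ) * max 1 ‖ω p‖ ^ 2 := by
  have hp : p ∈ ball p ρ := mem_ball_self hρ
  have hnear : ∀ᶠ y in 𝓝 p, y ∈ ball p ρ := ball_mem_nhds p hρ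
  have hM : 0 ≤ M := (norm_nonneg _).trans (hU p hp)
  have hS' := norm_deriv_center_le hρ hSd hS
  have hW' := norm_deriv_center_le hρ hWd hW
  have hU' := norm_deriv_center_le hρ hUd hU
  norm_num at hS' hW'
  have hUp := hU p hp
  set X := max 1 ‖ω p‖ with hX
  have hX1 : 1 ≤ X := le_max_left _ _
  have hXk : ∀ j, 1 ≤ X ^ j := fun j => one_le_pow₀ hX1
  have hbk : 1 ≤ b ^ k := one_le_pow₀ hb
  have hb1 : b ≤ b ^ k := le_self_pow₀ hb (by omega)
  have e1 : 0 ≤ 2 * M / ρ := by positivity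
  have e2 : 0 ≤ k * (4 * M / ρ) := by positivity
  have e3 : 0 ≤ 4 / ρ := by positivity
  set D := M + 2 * M / ρ + k * (4 * M / ρ) + 4 / ρ with hD
  have hbX : ∀ j (x y : ℝ), 0 ≤ x → x ≤ D → y ≤ b ^ k * x → y ≤ b ^ k * D * X ^ j := by
    intro j x y hx0 hxD hy
    calc y ≤ b ^ k * x := hy
      _ ≤ b ^ k * D := by gcongr
      _ ≤ b ^ k * D * X ^ j := le_mul_of_one_le_right (by positivity) (hXk j)
  have hD0 : 0 ≤ D := by linarith
  have hDX : ∀ j (x y : ℝ), x ≤ D → y ≤ x * X ^ j → y ≤ b ^ k * D * X ^ j := by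
    intro j x y hxD hy
    calc y ≤ x * X ^ j := hy
      _ ≤ D * X ^ j := by gcongr
      _ ≤ b ^ k * D * X ^ j := by
        gcongr
        exact le_mul_of_one_le_left hD0 hbk
  rcases hcase with ⟨α, hαb, hα⟩ | hW1
  · have hαS : ∀ y ∈ ball p ρ, S y = α⁻¹ := fun y hy => by
      rw [eq_inv_of_mul_eq_one_right (hα y hy)]
    have hω1 : ω =ᶠ[𝓝 p] fun y => α * W y := by
      filter_upwards [hω, hnear] with y h1 h2
      rw [h1, hαS y h2, div_inv_eq_mul, mul_comm]
    have hφ1 : φ =ᶠ[𝓝 p] fun y => α ^ k * U y := by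
      filter_upwards [hφ, hnear] with y h1 h2
      rw [h1, hαS y h2, inv_pow, div_inv_eq_mul, mul_comm]
    have hαk : ‖α‖ ^ k ≤ b ^ k := by gcongr
    refine ⟨hbX k M _ hM (by linarith) ?_, hbX _ (2 * M / ρ) _ e1 (by linarith) ?_,
      hbX _ (4 / ρ) _ e3 (by linarith) ?_⟩
    · rw [hφ1.self_of_nhds, norm_mul, norm_pow]
      gcongr
    · rw [hφ1.deriv_eq, deriv_const_mul_field, norm_mul, norm_pow]
      gcongr
    · rw [hω1.deriv_eq, deriv_const_mul_field, norm_mul]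
      gcongr
      exact hαb.trans hb1
  · have hSa : HasDerivAt S (deriv S p) p := (hSd.differentiableAt (ball_mem_nhds p hρ)).hasDerivAt
    have hUa : HasDerivAt U (deriv U p) p := (hUd.differentiableAt (ball_mem_nhds p hρ)).hasDerivAt
    have hω1 : ω =ᶠ[𝓝 p] fun y => (S y)⁻¹ := by
      filter_upwards [hω, hnear] with y h1 h2
      rw [h1, hW1 y h2, one_div]
    have hφ1 : φ =ᶠ[𝓝 p] fun y => U y * (S y)⁻¹ ^ k := by
      filter_upwards [hφ, hnear] with y h1 h2
      rw [h1, inv_pow, div_eq_mul_inv]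
    have hωp : ω p = (S p)⁻¹ := hω1.self_of_nhds
    have hωX : ‖ω p‖ ≤ X := le_max_right _ _
    have hI : HasDerivAt (fun y => (S y)⁻¹) (-deriv S p / S p ^ 2) p := hSa.fun_inv hS0
    have hIeq : -deriv S p / S p ^ 2 = -deriv S p * ω p ^ 2 := by rw [hωp]; field_simp
    rw [hIeq] at hI
    refine ⟨hDX k M _ (by linarith) ?_,
      hDX _ (2 * M / ρ + k * (4 * M / ρ)) _ (by linarith) ?_, hDX _ (4 / ρ) _ (by linarith) ?_⟩
    · rw [hφ1.self_of_nhds]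
      beta_reduce
      rw [← hωp, norm_mul, norm_pow]
      gcongr
    · rw [hφ1.deriv_eq, (hUa.fun_mul (hI.fun_pow k)).deriv, ← hωp]
      have h1 : ‖deriv U p * ω p ^ k‖ ≤ 2 * M / ρ * X ^ (k + 1) := by
        rw [norm_mul, norm_pow]
        calc ‖deriv U p‖ * ‖ω p‖ ^ k ≤ 2 * M / ρ * X ^ k := by gcongr
          _ ≤ 2 * M / ρ * X ^ (k + 1) := by gcongr; omega
      have h2 : ‖U p * (k * ω p ^ (k - 1) * (-deriv S p * ω p ^ 2))‖ ≤
          k * (4 * M / ρ) * X ^ (k + 1) := by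
        obtain ⟨j, rfl⟩ : ∃ j, k = j + 1 := ⟨k - 1, by omega⟩
        have : U p * ((j + 1 : ℕ) * ω p ^ (j + 1 - 1) * (-deriv S p * ω p ^ 2)) =
            (j + 1 : ℕ) * (-U p * deriv S p) * ω p ^ (j + 1 + 1) := by
          rw [Nat.add_sub_cancel]; ring
        rw [this, norm_mul, norm_mul, norm_mul, norm_neg, norm_pow, Complex.norm_natCast]
        calc (j + 1 : ℕ) * (‖U p‖ * ‖deriv S p‖) * ‖ω p‖ ^ (j + 1 + 1)
            ≤ (j + 1 : ℕ) * (M * (4 / ρ)) * X ^ (j + 1 + 1) := by gcongr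
          _ = (j + 1 : ℕ) * (4 * M / ρ) * X ^ (j + 1 + 1) := by ring
      refine (norm_add_le _ _).trans ?_
      rw [add_mul]
      exact add_le_add h1 h2
    · rw [hω1.deriv_eq, hI.deriv, norm_mul, norm_neg, norm_pow]
      gcongr

namespace CoverLimit

variable {n k m : ℕ} {F : MvPolynomial (Fin (n + 1)) ℂ}
  {P : Fin n → MvPolynomial (Fin (n + 1)) ℂ}

lemma exists_transition (L : CoverLimit F P k m) (p : ℂ) {y : ℂ} (hy : y ∈ ball p L.ρ) :
    ∃ t : ℂ, t ≠ 0 ∧ (∀ i, L.H p i y = t * L.H y i y) ∧ L.U p y = t ^ k * L.U y y := by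
  have hyy : y ∈ ball y L.ρ := mem_ball_self L.ρ_pos
  have h1 : ∀ i, L.H p i y = L.H p (L.s y) y * L.H y i y := fun i => by
    have h := L.compat p y y hy hyy i (L.s y)
    rwa [L.H_self y y hyy, mul_one] at h
  refine ⟨L.H p (L.s y) y, fun h0 => ?_, h1, ?_⟩
  · have h := h1 (L.s p)
    rw [L.H_self p y hy, h0, zero_mul] at h
    exact one_ne_zero h
  · have h := L.compatU p y y hy hyy (L.s y)
    rw [L.H_self y y hyy, one_pow, mul_one] at h
    rw [h, mul_comm]

/-- If the projection of the limit curve is a point outside the common zero locus of the `P i`, then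
the limit curve is constant, which is absurd. -/
lemma false_of_proj_const (L : CoverLimit F P k m) (hk : 1 ≤ k) (hm : n + 3 ≤ m)
    (hP : ∀ i : Fin n, (P i).IsHomogeneous (k * (m - i)))
    {a : Fin (n + 1) → ℂ} {l₀ : Fin (n + 1)} (haP : ∃ i, eval a (P i) ≠ 0)
    (hH : ∀ p, ∀ y ∈ ball p L.ρ, ∀ l,
      L.H p (Fin.castSucc l) y = a l * L.H p (Fin.castSucc l₀) y) : False := by
  set σ : Fin (n + 2) := Fin.castSucc l₀ with hσ
  set ν : Fin (n + 2) := Fin.last (n + 1) with hν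
  have hρ := L.ρ_pos
  have hself : ∀ y : ℂ, y ∈ ball y L.ρ := fun y => mem_ball_self hρ
  set T : Set ℂ := {y | L.H y σ y = 0} with hTdef
  set ω : ℂ → ℂ := fun y => L.H y ν y / L.H y σ y with hωdef
  set φ : ℂ → ℂ := fun y => L.U y y / L.H y σ y ^ k with hφdef
  have hTp : ∀ p, ∀ y ∈ ball p L.ρ, y ∈ T ↔ L.H p σ y = 0 := by
    intro p y hy
    obtain ⟨t, ht, h1, -⟩ := L.exists_transition p hy
    simp [hTdef, h1 σ, ht]
  have hωp : ∀ p, ∀ y ∈ ball p L.ρ, ω y = L.H p ν y / L.H p σ y := by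
    intro p y hy
    obtain ⟨t, ht, h1, -⟩ := L.exists_transition p hy
    rw [h1 ν, h1 σ, mul_div_mul_left _ _ ht]
  have hφp : ∀ p, ∀ y ∈ ball p L.ρ, φ y = L.U p y / L.H p σ y ^ k := by
    intro p y hy
    obtain ⟨t, ht, h1, h2⟩ := L.exists_transition p hy
    rw [h2, h1 σ, mul_pow, mul_div_mul_left _ _ (pow_ne_zero k ht)]
  have hωe : ∀ p, ω =ᶠ[𝓝 p] fun y => L.H p ν y / L.H p σ y := fun p => by
    filter_upwards [ball_mem_nhds p hρ] with y hy using hωp p y hy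
  have hφe : ∀ p, φ =ᶠ[𝓝 p] fun y => L.U p y / L.H p σ y ^ k := fun p => by
    filter_upwards [ball_mem_nhds p hρ] with y hy using hφp p y hy
  have hdH : ∀ p l, DifferentiableAt ℂ (L.H p l) p := fun p l =>
    (L.diffH p l).differentiableAt (ball_mem_nhds p hρ)
  have hdU : ∀ p, DifferentiableAt ℂ (L.U p) p := fun p =>
    (L.diffU p).differentiableAt (ball_mem_nhds p hρ)
  have hT : ∀ p, ∀ᶠ y in 𝓝[≠] p, y ∉ T := by
    intro p
    rcases (L.analyticOnNhd_H p σ p (hself p)).eventually_eq_zero_or_eventually_ne_zero with h | h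
    · refine absurd ?_ (L.not_eventually_eq_zero p)
      filter_upwards [h, ball_mem_nhds p hρ] with y h1 h2 i
      rw [hH p y h2 i, h1, mul_zero]
    · filter_upwards [h, nhdsWithin_le_nhds (ball_mem_nhds p hρ)] with y h1 h2
      rwa [hTp p y h2]
  set q : Polynomial ℂ := ∑ i : Fin n, Polynomial.C (eval a (P i)) * Polynomial.X ^ (i : ℕ) with hq
  obtain ⟨i₁, hi₁⟩ := haP
  have hn : 1 ≤ n := Nat.one_le_iff_ne_zero.2 fun h => (h ▸ i₁).elim0
  have hq0 : q ≠ 0 := by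
    intro h
    apply hi₁
    have h1 : q.coeff i₁ = eval a (P i₁) := by
      rw [hq, Polynomial.finsetSum_coeff]
      simp only [Polynomial.coeff_C_mul_X_pow]
      rw [Finset.sum_eq_single i₁]
      · simp
      · intro j _ hj
        exact if_neg fun h => hj (Fin.ext h.symm)
      · simp
    rw [← h1, h, Polynomial.coeff_zero]
  have hqdeg : q.natDegree ≤ n - 1 := by
    refine Polynomial.natDegree_sum_le_of_forall_le _ _ fun i _ => ?_
    exact (Polynomial.natDegree_C_mul_X_pow_le _ _).trans (by omega)
  have heq : ∀ y, y ∉ T → ω y ^ (k * m) = φ y ^ m + q.eval (φ y) := by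
    intro y hy
    have hS : L.H y σ y ≠ 0 := hy
    have h1 := L.eq y y (hself y)
    have h2 : (fun i : Fin (n + 1) => L.H y (Fin.castSucc i) y) = fun i => L.H y σ y * a i := by
      funext i
      rw [hH y y (hself y) i, mul_comm]
    rw [h2] at h1
    simp only [(hP _).eval_mul_left] at h1
    have h3 : q.eval (φ y) = ∑ i : Fin n, eval a (P i) * φ y ^ (i : ℕ) := by
      simp [hq, Polynomial.eval_finsetSum]
    rw [h3]
    apply mul_left_cancel₀ (pow_ne_zero (k * m) hS)
    have h4 : L.H y σ y ^ (k * m) * ω y ^ (k * m) = L.H y ν y ^ (k * m) := by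
      rw [← mul_pow, hωdef, mul_div_cancel₀ _ hS]
    have h5 : ∀ j : ℕ, (L.H y σ y ^ k) ^ j * φ y ^ j = L.U y y ^ j := by
      intro j
      rw [← mul_pow, hφdef, mul_div_cancel₀ _ (pow_ne_zero k hS)]
    rw [h4, h1, mul_add, pow_mul, h5, Finset.mul_sum]
    congr 1
    refine Finset.sum_congr rfl fun i _ => ?_
    have h6 : k * m = k * (m - i) + k * i := by
      rw [← mul_add, Nat.sub_add_cancel (by omega)]
    rw [← h5, ← pow_mul, ← pow_mul, h6, pow_add]
    ring
  set b : ℝ := 1 + ∑ i, ‖a i‖ with hb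
  have hb1 : 1 ≤ b := le_add_of_nonneg_right (Finset.sum_nonneg fun i _ => norm_nonneg _)
  have hab : ∀ i, ‖a i‖ ≤ b := fun i =>
    (Finset.single_le_sum (f := fun i => ‖a i‖) (fun i _ => norm_nonneg _)
      (Finset.mem_univ i)).trans (by linarith)
  have hbd := fun y (hy : y ∉ T) => affine_chart_bounds (M := L.M) (b := b) hk hρ hb1 (L.diffH y σ)
    (L.diffH y ν) (L.diffU y) (L.norm_H_le y σ) (L.norm_H_le y ν) (L.norm_U_le y) hy (hωe y) (hφe y)
    (by
      by_cases hs : L.s y = ν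
      · exact Or.inr fun x hx => hs ▸ L.H_self y x hx
      · obtain ⟨i, hi⟩ := Fin.exists_castSucc_eq.2 hs
        refine Or.inl ⟨a i, hab i, fun x hx => ?_⟩
        rw [← hH y x hx i, hi, L.H_self y x hx])
  have hdω := deriv_eq_zero_of_pow_eq_eval hk hq0 (by omega) hT
    (fun y hy => (((hdH y ν).div (hdH y σ) hy).congr_of_eventuallyEq (hωe y)))
    (fun y hy => (((hdU y).div ((hdH y σ).pow k) (pow_ne_zero k hy)).congr_of_eventuallyEq (hφe y)))
    heq (fun y hy => (hbd y hy).1) (fun y hy => (hbd y hy).2.1) (fun y hy => (hbd y hy).2.2)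
  obtain ⟨l, hl⟩ := L.deriv_ne
  have h0 := hself 0
  by_cases hs : L.s 0 = ν
  · have hW : ∀ y ∈ ball 0 L.ρ, L.H 0 ν y = 1 := fun y hy => hs ▸ L.H_self 0 y hy
    have hS' : ∀ᶠ y in 𝓝[≠] (0 : ℂ), deriv (L.H 0 σ) y = 0 := by
      filter_upwards [hT 0, nhdsWithin_le_nhds (ball_mem_nhds 0 hρ)] with y hy hyb
      have h1 : ω =ᶠ[𝓝 y] fun x => (L.H 0 σ x)⁻¹ := by
        filter_upwards [isOpen_ball.mem_nhds hyb] with x hx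
        rw [hωp 0 x hx, hW x hx, one_div]
      have hS : L.H 0 σ y ≠ 0 := by rwa [hTp 0 y hyb] at hy
      have h2 := ((L.diffH 0 σ).differentiableAt (isOpen_ball.mem_nhds hyb)).hasDerivAt.fun_inv hS
      have h3 := hdω y hy
      rw [h1.deriv_eq, h2.deriv, div_eq_zero_iff] at h3
      simpa using h3.resolve_right (pow_ne_zero 2 hS)
    have hS0 : deriv (L.H 0 σ) 0 = 0 := by
      have hc : ContinuousAt (deriv (L.H 0 σ)) 0 :=
        (L.analyticOnNhd_H 0 σ 0 h0).deriv.continuousAt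
      refine tendsto_nhds_unique (hc.tendsto.mono_left nhdsWithin_le_nhds) ?_ (l := 𝓝[≠] 0)
      exact tendsto_const_nhds.congr' (hS'.mono fun y hy => hy.symm)
    refine hl ?_
    refine Fin.lastCases ?_ (fun i => ?_) l
    · have : L.H 0 ν =ᶠ[𝓝 0] fun _ => 1 := by
        filter_upwards [ball_mem_nhds 0 hρ] with y hy using hW y hy
      rw [this.deriv_eq, deriv_const]
    · have : L.H 0 (Fin.castSucc i) =ᶠ[𝓝 0] fun y => a i * L.H 0 σ y := by
        filter_upwards [ball_mem_nhds 0 hρ] with y hy using hH 0 y hy i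
      rw [this.deriv_eq, deriv_const_mul_field, hS0, mul_zero]
  · obtain ⟨i, hi⟩ := Fin.exists_castSucc_eq.2 hs
    have hS : ∀ y ∈ ball 0 L.ρ, a i * L.H 0 σ y = 1 := fun y hy => by
      rw [← hH 0 y hy i, hi, L.H_self 0 y hy]
    have hSi : ∀ y ∈ ball 0 L.ρ, L.H 0 σ y = (a i)⁻¹ := fun y hy =>
      eq_inv_of_mul_eq_one_right (hS y hy)
    have hai : a i ≠ 0 := left_ne_zero_of_mul_eq_one (hS 0 h0)
    refine hl ?_
    refine Fin.lastCases ?_ (fun j => ?_) l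
    · have h1 : L.H 0 ν =ᶠ[𝓝 0] fun y => (a i)⁻¹ * ω y := by
        filter_upwards [ball_mem_nhds 0 hρ] with y hy
        rw [hωp 0 y hy, hSi y hy]
        field_simp
      rw [h1.deriv_eq, deriv_const_mul_field, hdω 0, mul_zero]
      rw [hTp 0 0 h0]
      exact right_ne_zero_of_mul_eq_one (hS 0 h0)
    · have : L.H 0 (Fin.castSucc j) =ᶠ[𝓝 0] fun _ => a j * (a i)⁻¹ := by
        filter_upwards [ball_mem_nhds 0 hρ] with y hy
        rw [hH 0 y hy j, hSi y hy]
      rw [this.deriv_eq, deriv_const]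

end CoverLimit

/-- A point of projective space outside `F = 0` is the common zero locus of `n` linear forms; their
powers have no common zero on `F = 0`. -/
lemma exists_powers_of_linear_forms {n k : ℕ} {F : MvPolynomial (Fin (n + 1)) ℂ} (hk : 1 ≤ k)
    (hF0 : F ≠ 0) (hF : F.IsHomogeneous k) (d : Fin n → ℕ) :
    ∃ P : Fin n → MvPolynomial (Fin (n + 1)) ℂ, (∀ i, (P i).IsHomogeneous (d i)) ∧
      ∀ a : Fin (n + 1) → ℂ, a ≠ 0 → eval a F = 0 → ∃ i, eval a (P i) ≠ 0 := by
  obtain ⟨p, hp⟩ : ∃ p, eval p F ≠ 0 := by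
    by_contra! h
    exact hF0 (MvPolynomial.funext fun x => by rw [h x, map_zero])
  obtain ⟨i₀, hi₀⟩ : ∃ i, p i ≠ 0 := by
    by_contra! h
    have h1 := hF.eval_mul_left 0 p
    rw [zero_pow (by omega), zero_mul] at h1
    refine hp (h1 ▸ ?_)
    congr 2
    funext i
    rw [h i, zero_mul]
  refine ⟨fun i => (C (p i₀) * X (i₀.succAbove i) - C (p (i₀.succAbove i)) * X i₀) ^ d i,
    fun i => ?_, fun a ha haF => ?_⟩
  · have h1 : (C (p i₀) * X (i₀.succAbove i) - C (p (i₀.succAbove i)) * X i₀ :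
        MvPolynomial (Fin (n + 1)) ℂ).IsHomogeneous 1 :=
      ((isHomogeneous_X ℂ _).C_mul _).sub ((isHomogeneous_X ℂ _).C_mul _)
    simpa using h1.pow (d i)
  · by_contra! h
    have h1 : ∀ i, a i = a i₀ / p i₀ * p i := by
      intro i
      rcases Fin.eq_self_or_eq_succAbove i₀ i with rfl | ⟨j, rfl⟩
      · rw [div_mul_cancel₀ _ hi₀]
      · have h2 := h j
        rw [map_pow] at h2
        have h3 := eq_zero_of_pow_eq_zero h2
        simp only [map_sub, map_mul, eval_C, eval_X] at h3
        rw [div_mul_eq_mul_div, eq_div_iff hi₀]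
        linear_combination h3
    have h4 : a = fun i => a i₀ / p i₀ * p i := funext h1
    rw [h4, hF.eval_mul_left] at haF
    have h5 := eq_zero_of_pow_eq_zero ((mul_eq_zero.1 haF).resolve_right hp)
    exact ha (h4.trans (by funext i; simp [h5]))

lemma exists_hyperbolic_coverPoly {n k m : ℕ} {F : MvPolynomial (Fin (n + 1)) ℂ}
    {P : Fin n → MvPolynomial (Fin (n + 1)) ℂ} (hk : 1 ≤ k) (hm : n + 3 ≤ m)
    (hF : F.IsHomogeneous k) (hB : IsBrodyHyperbolicHypersurface F)
    (hP : ∀ i : Fin n, (P i).IsHomogeneous (k * (m - i)))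
    (haP : ∀ a : Fin (n + 1) → ℂ, a ≠ 0 → eval a F = 0 → ∃ i, eval a (P i) ≠ 0)
    {c : ℕ → Fin (n + 1) → ℂ} (hc : ∀ j i, ‖c j i‖ ≤ 1 / (j + 1))
    (hhom : ∀ j : ℕ, (coverPoly F P m (k * m) j (c j)).IsHomogeneous (k * m)) :
    ∃ j : ℕ, IsBrodyHyperbolicHypersurface (X (Fin.last (n + 1)) ^ (k * m) -
      rename Fin.castSucc (coverPoly F P m (k * m) j (c j)) : MvPolynomial (Fin (n + 2)) ℂ) := by
  by_contra! hcon
  have hg : ∀ j : ℕ, ∃ g : Fin (n + 2) → ℂ → ℂ, (∀ i, Differentiable ℂ (g i)) ∧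
      (∀ y, ∃ i, g i y ≠ 0) ∧ (∀ y ∈ closedBall (0 : ℂ) j, projDensity g y ≤ 2) ∧
      projDensity g 0 = 1 ∧ ∀ y, g (Fin.last (n + 1)) y ^ (k * m) =
        eval (fun i => g (Fin.castSucc i) y) (coverPoly F P m (k * m) j (c j)) := by
    intro j
    have h := hcon j
    unfold IsBrodyHyperbolicHypersurface at h
    push Not at h
    obtain ⟨f, hfd, hf0, hfe, hf⟩ := h
    obtain ⟨x₀, hx₀⟩ : ∃ x₀, projDensity f x₀ ≠ 0 := by
      by_contra! h0
      obtain ⟨a, u, hu, hau⟩ := exists_eq_const_mul_of_projDensity_eq_zero hfd hf0 h0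
      obtain ⟨i, z, hne⟩ := hf a u hu
      exact hne (hau i z)
    obtain ⟨a, b, h1, h2⟩ := exists_affine_reparametrization hfd hf0 hx₀
      (R := j + 1) (by positivity)
    refine ⟨fun i x => f i (a + b * x), fun i => (hfd i).comp (by fun_prop), fun y => hf0 _,
      fun y hy => h2 y (closedBall_subset_closedBall (by linarith) hy), h1, fun y => ?_⟩
    have h3 := hfe (a + b * y)
    rw [map_sub, map_pow, eval_X, eval_rename, sub_eq_zero] at h3
    exact h3
  choose g hgd hg0 hgD hgD1 hge using hg
  obtain ⟨L⟩ := nonempty_coverLimit hF (by omega) hc hhom hgd hg0 hgD hgD1 hge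
  obtain ⟨a, l₀, hal, haF, haH⟩ := L.exists_proj_const hF hB
  refine L.false_of_proj_const hk hm hP (haP a (fun h => ?_) haF) haH
  rw [h] at hal
  exact zero_ne_one hal

end

/-- Theorem 4.1 (1): if there is a smooth Brody hyperbolic hypersurface of
degree `k` in ℙⁿ and `δ` is a multiple of `k` with `δ ≥ (n+3)k`, then there is
a Brody hyperbolic smooth hypersurface `W = {z_{n+1}^δ = G(z_0, …, z_n)}` of
degree `δ` in ℙ^{n+1}, a cyclic cover of ℙⁿ under a linear projection. -/
theorem exists_hyperbolic_cyclic_cover_hypersurface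
    (n k : ℕ) (hn : 1 ≤ n) (hk : 1 ≤ k)
    (hexists : ∃ F : MvPolynomial (Fin (n + 1)) ℂ, F ≠ 0 ∧ F.IsHomogeneous k ∧
      IsSmoothHypersurface F ∧ IsBrodyHyperbolicHypersurface F)
    (δ : ℕ) (hkδ : k ∣ δ) (hδ : (n + 3) * k ≤ δ) :
    ∃ G : MvPolynomial (Fin (n + 1)) ℂ, G.IsHomogeneous δ ∧
      IsSmoothHypersurface
        (X (Fin.last (n + 1)) ^ δ - rename Fin.castSucc G :
          MvPolynomial (Fin (n + 2)) ℂ) ∧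
      IsBrodyHyperbolicHypersurface
        (X (Fin.last (n + 1)) ^ δ - rename Fin.castSucc G :
          MvPolynomial (Fin (n + 2)) ℂ) := by
  obtain ⟨F, hF0, hF, -, hB⟩ := hexists
  obtain ⟨m, rfl⟩ := hkδ
  have hm : n + 3 ≤ m := by
    rw [mul_comm] at hδ
    exact Nat.le_of_mul_le_mul_left hδ hk
  have hδ1 : 1 ≤ k * m := Nat.mul_pos hk (by omega)
  obtain ⟨P, hP, haP⟩ := exists_powers_of_linear_forms hk hF0 hF fun i : Fin n => k * (m - i)
  have hA : ∀ j : ℕ, ((C (j : ℂ) * F) ^ m + ∑ i, P i * (C (j : ℂ) * F) ^ (i : ℕ)).IsHomogeneous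
      (k * m) := by
    intro j
    refine ((hF.C_mul _).pow m).add (IsHomogeneous.sum _ _ _ fun i _ => ?_)
    have h : k * m = k * (m - i) + k * i := by
      rw [← mul_add, Nat.sub_add_cancel (by omega)]
    rw [h]
    exact (hP i).mul ((hF.C_mul _).pow i)
  choose c hc hcs using fun j : ℕ =>
    exists_forall_pderiv_add_sum_X_pow_ne_zero (hA j) hδ1 (Nat.one_div_pos_of_nat (n := j) (α := ℝ))
  have hhom : ∀ j : ℕ, (coverPoly F P m (k * m) j (c j)).IsHomogeneous (k * m) := by
    intro j
    refine (hA j).add (IsHomogeneous.sum _ _ _ fun i _ => ?_)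
    simpa using ((isHomogeneous_X ℂ i).pow (k * m)).C_mul (c j i)
  obtain ⟨j, hj⟩ := exists_hyperbolic_coverPoly hk hm hF hB hP haP (fun j i => (hc j i).le) hhom
  exact ⟨_, hhom j, fun x hx _ => smooth_cyclic_cover hδ1 (hcs j) x hx, hj⟩
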